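/- arXiv:2203.16390 — 8 statements merged into one kernel-verified Lean document; each statement's English description precedes it below -/
import Mathlib

section
/- For every integer c ≥ 4 and for d ∈ {4, 5}, if v is a vertex of degree d in a c-PCF-critical graph G and v is adjacent to a 3-thread, then the number of 2-threads adjacent to v is at most 3d + n_{3+}(v) − 11, where n_{3+}(v) is the number of neighbors of v of degree at least 3. -/
open SimpleGraph

/-- A proper conflict-free coloring with colors in `Fin c`. -/
def IsPCFColoring {V : Type*} {c : ℕ} (G : SimpleGraph V) (f : V → Fin c) : Prop :=
  (∀ ⦃u v : V⦄, G.Adj u v → f u ≠ f v) ∧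
  ∀ v : V, (∃ u, G.Adj v u) →
    ∃ u, G.Adj v u ∧ ∀ w, G.Adj v w → f w = f u → w = u

/-- `mad(G) ≤ q` : every nonempty subgraph has average degree at most `q`. -/
def MadLE {V : Type*} (G : SimpleGraph V) (q : ℚ) : Prop :=
  ∀ H : G.Subgraph, H.verts.Nonempty →
    (2 * H.edgeSet.ncard : ℚ) ≤ q * H.verts.ncard

def MadLT {V : Type*} (G : SimpleGraph V) (q : ℚ) : Prop :=
  ∀ H : G.Subgraph, H.verts.Nonempty →
    (2 * H.edgeSet.ncard : ℚ) < q * H.verts.ncard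

/-- `G` contains a copy of `H` as a (not necessarily induced) subgraph. -/
def ContainsSubgraph {V W : Type*} (G : SimpleGraph V) (H : SimpleGraph W) : Prop :=
  ∃ f : W → V, Function.Injective f ∧ ∀ ⦃a b : W⦄, H.Adj a b → G.Adj (f a) (f b)

/-- The 1-subdivision of a graph: subdivide every edge exactly once. -/
def Subdiv {V : Type*} (G : SimpleGraph V) : SimpleGraph (V ⊕ G.edgeSet) :=
  SimpleGraph.fromRel (fun a b =>
    match a, b with
    | Sum.inl v, Sum.inr e => v ∈ (e : Sym2 V)
    | _, _ => False)

/-- `K*_n`, the 1-subdivision of the complete graph on `n` vertices. -/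
def KStarGraph (n : ℕ) : SimpleGraph (Fin n ⊕ (completeGraph (Fin n)).edgeSet) :=
  Subdiv (completeGraph (Fin n))

/-- `G` is `c`-PCF-critical: `G` has no PCF `c`-coloring, but every proper
subgraph of `G` has one. -/
def PCFCritical {V : Type*} (G : SimpleGraph V) (c : ℕ) : Prop :=
  (¬ ∃ f : V → Fin c, IsPCFColoring G f) ∧
  ∀ H : G.Subgraph, H ≠ ⊤ → ∃ f : H.verts → Fin c, IsPCFColoring H.coe f

/-- `n_d(v)`: the number of neighbors of `v` having degree exactly `d`. -/
noncomputable def nDeg {V : Type*} [Fintype V] (G : SimpleGraph V) [DecidableRel G.Adj]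
    (v : V) (d : ℕ) : ℕ :=
  {u | G.Adj v u ∧ G.degree u = d}.ncard

/-- `n_{d+}(v)`: the number of neighbors of `v` having degree at least `d`. -/
noncomputable def nDegGE {V : Type*} [Fintype V] (G : SimpleGraph V) [DecidableRel G.Adj]
    (v : V) (d : ℕ) : ℕ :=
  {u | G.Adj v u ∧ d ≤ G.degree u}.ncard

/-- `p` has exactly two neighbors, `a` and `b`. -/
def HasNbrPair {V : Type*} (G : SimpleGraph V) (p a b : V) : Prop :=
  a ≠ b ∧ ∀ t, G.Adj p t ↔ t = a ∨ t = b

/-- If `w` has a neighbor in `D`, then some color appears exactly once among those neighbors. -/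
def ConflictFreeAt {V : Type*} {c : ℕ} (G : SimpleGraph V) (D : Set V) (f : V → Fin c)
    (w : V) : Prop :=
  (∃ s ∈ D, G.Adj w s) → ∃ s ∈ D, G.Adj w s ∧ ∀ t ∈ D, G.Adj w t → f t = f s → t = s

/-- As `ConflictFreeAt`, with the color appearing exactly once different from `b`. -/
def ConflictFreeAvoiding {V : Type*} {c : ℕ} (G : SimpleGraph V) (D : Set V) (f : V → Fin c)
    (w : V) (b : Fin c) : Prop :=
  (∃ s ∈ D, G.Adj w s) →
    ∃ s ∈ D, G.Adj w s ∧ f s ≠ b ∧ ∀ t ∈ D, G.Adj w t → f t = f s → t = s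

/-- `f` restricted to `D` is a PCF coloring of the graph induced on `D`, except that the
conflict-free condition is not imposed at `v`. -/
def IsPartialPCF {V : Type*} {c : ℕ} (G : SimpleGraph V) (v : V) (D : Set V)
    (f : V → Fin c) : Prop :=
  (∀ u ∈ D, ∀ w ∈ D, G.Adj u w → f u ≠ f w) ∧ ∀ u ∈ D, u ≠ v → ConflictFreeAt G D f u

section Basic

variable {V : Type*} {c : ℕ} {G : SimpleGraph V} {v : V} {D : Set V} {f : V → Fin c}

theorem exists_color_avoiding_three (hc : 4 ≤ c) (p q r : Fin c) :
    ∃ b, b ≠ p ∧ b ≠ q ∧ b ≠ r := by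
  have hcard : ({p, q, r} : Finset (Fin c)).card < Fintype.card (Fin c) := by
    rw [Fintype.card_fin]
    exact lt_of_le_of_lt Finset.card_le_three (by omega)
  obtain ⟨b, hb⟩ := Finset.exists_mem_notMem_of_card_lt_card
    (t := (Finset.univ : Finset (Fin c))) (by simpa using hcard)
  exact ⟨b, by simpa using hb.2⟩

namespace HasNbrPair

variable {p a b : V}

theorem left (h : HasNbrPair G p a b) : G.Adj p a := (h.2 a).2 (Or.inl rfl)

theorem right (h : HasNbrPair G p a b) : G.Adj p b := (h.2 b).2 (Or.inr rfl)

theorem swap (h : HasNbrPair G p a b) : HasNbrPair G p b a :=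
  ⟨h.1.symm, fun t => (h.2 t).trans or_comm⟩

theorem exists_of_degree_eq_two [Fintype V] [DecidableRel G.Adj] (hp : G.degree p = 2)
    (ha : G.Adj p a) : ∃ b, HasNbrPair G p a b := by
  classical
  rw [← SimpleGraph.card_neighborFinset_eq_degree, Finset.card_eq_two] at hp
  obtain ⟨x, y, hxy, h⟩ := hp
  have key : ∀ t, G.Adj p t ↔ t = x ∨ t = y := fun t => by
    rw [← SimpleGraph.mem_neighborFinset, h]; simp
  rcases (key a).1 ha with rfl | rfl
  · exact ⟨y, hxy, key⟩
  · exact ⟨x, hxy.symm, fun t => (key t).trans or_comm⟩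

end HasNbrPair

theorem PCFCritical.exists_coloring (hG : PCFCritical G c) (hc : 0 < c) (hD : D ≠ Set.univ) :
    ∃ f : V → Fin c, (∀ u ∈ D, ∀ w ∈ D, G.Adj u w → f u ≠ f w) ∧
      ∀ u ∈ D, ConflictFreeAt G D f u := by
  classical
  obtain ⟨f, hf, hf'⟩ := hG.2 ((⊤ : G.Subgraph).induce D) (fun h => hD (by
    simpa using congrArg SimpleGraph.Subgraph.verts h))
  refine ⟨fun t => if h : t ∈ D then f ⟨t, h⟩ else ⟨0, hc⟩, ?_, ?_⟩
  · intro u hu w hw huw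
    simpa [hu, hw] using @hf ⟨u, hu⟩ ⟨w, hw⟩ (by simpa [hu, hw] using huw)
  · rintro u hu ⟨s, hs, hus⟩
    obtain ⟨⟨r, hr⟩, hur, huniq⟩ := hf' ⟨u, hu⟩ ⟨⟨s, hs⟩, by simpa [hu, hs] using hus⟩
    replace hr : r ∈ D := hr
    refine ⟨r, hr, by simpa [hu, hr] using hur, fun t ht hut htr => ?_⟩
    exact congrArg Subtype.val
      (huniq ⟨t, ht⟩ (by simpa [hu, ht] using hut) (by simpa [ht, hr] using htr))

namespace IsPartialPCF

theorem exists_conflictFreeAvoiding (h : IsPartialPCF G v D f) {w : V} (hw : w ∈ D)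
    (hwv : w ≠ v) : ∃ α, ∀ b, b ≠ α → ConflictFreeAvoiding G D f w b := by
  by_cases hs : ∃ s ∈ D, G.Adj w s
  · obtain ⟨s, hsD, hws, huniq⟩ := h.2 w hw hwv hs
    exact ⟨f s, fun b hb _ => ⟨s, hsD, hws, hb.symm, huniq⟩⟩
  · exact ⟨f v, fun b _ hs' => absurd hs' hs⟩

theorem insert_update [DecidableEq V] (h : IsPartialPCF G v D f) {u : V} {b : Fin c} (hu : u ∉ D)
    (hb : ∀ w ∈ D, G.Adj u w → f w ≠ b)
    (hkeep : ∀ w ∈ D, G.Adj u w → w ≠ v → ConflictFreeAvoiding G D f w b)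
    (hcf : u ≠ v → ConflictFreeAt G D f u) :
    IsPartialPCF G v (insert u D) (Function.update f u b) := by
  have hne : ∀ w ∈ D, w ≠ u := fun w hw hwu => hu (hwu ▸ hw)
  have hval : ∀ w ∈ D, Function.update f u b w = f w := fun w hw => by simp [hne w hw]
  refine ⟨?_, ?_⟩
  · rintro p (rfl | hp) q (rfl | hq) hpq
    · exact absurd hpq (G.loopless.irrefl _)
    · rw [hval q hq, Function.update_self]
      exact (hb q hq hpq).symm
    · rw [hval p hp, Function.update_self]
      exact hb p hp hpq.symm
    · rw [hval p hp, hval q hq]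
      exact h.1 p hp q hq hpq
  · rintro w (rfl | hw) hwv
    · rintro ⟨s, hs, hws⟩
      have hsD : s ∈ D := hs.resolve_left hws.ne'
      obtain ⟨r, hr, hwr, huniq⟩ := hcf hwv ⟨s, hsD, hws⟩
      refine ⟨r, Or.inr hr, hwr, fun t ht hwt htr => ?_⟩
      have htD : t ∈ D := ht.resolve_left hwt.ne'
      rw [hval t htD, hval r hr] at htr
      exact huniq t htD hwt htr
    · rintro ⟨s, hs, hws⟩
      by_cases huw : G.Adj u w
      · by_cases hex : ∃ s ∈ D, G.Adj w s
        · obtain ⟨r, hr, hwr, hrb, huniq⟩ := hkeep w hw huw hwv hex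
          refine ⟨r, Or.inr hr, hwr, ?_⟩
          rintro t (rfl | ht) hwt htr
          · rw [hval r hr, Function.update_self] at htr
            exact absurd htr.symm hrb
          · rw [hval t ht, hval r hr] at htr
            exact huniq t ht hwt htr
        · refine ⟨u, Or.inl rfl, huw.symm, ?_⟩
          rintro t (rfl | ht) hwt -
          · rfl
          · exact absurd ⟨t, ht, hwt⟩ hex
      · have hsD : s ∈ D := hs.resolve_left (fun hsu => huw (hsu ▸ hws.symm))
        obtain ⟨r, hr, hwr, huniq⟩ := h.2 w hw hwv ⟨s, hsD, hws⟩
        refine ⟨r, Or.inr hr, hwr, fun t ht hwt htr => ?_⟩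
        have htD : t ∈ D := ht.resolve_left (fun htu => huw (htu ▸ hwt.symm))
        rw [hval t htD, hval r hr] at htr
        exact huniq t htD hwt htr

/-- A partial PCF coloring extends over a finite set whose vertices can be added in any order. -/
theorem exists_extension [DecidableEq V] (h : IsPartialPCF G v D f) (S : Finset V)
    (Q : V → Fin c → Prop)
    (step : ∀ (E : Set V) (g : V → Fin c), IsPartialPCF G v E g → D ⊆ E → E ⊆ D ∪ S →
      (∀ t ∈ D, g t = f t) → (∀ u ∈ E, u ∉ D → Q u (g u)) → ∀ u ∈ S, u ∉ E →
        ∃ b, Q u b ∧ IsPartialPCF G v (insert u E) (Function.update g u b)) :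
    ∃ g : V → Fin c, IsPartialPCF G v (D ∪ S) g ∧ (∀ t ∈ D, g t = f t) ∧
      ∀ u ∈ S, u ∉ D → Q u (g u) := by
  have main : ∀ T : Finset V, T ⊆ S → ∃ g : V → Fin c, IsPartialPCF G v (D ∪ T) g ∧
      (∀ t ∈ D, g t = f t) ∧ ∀ u ∈ T, u ∉ D → Q u (g u) := by
    intro T
    induction T using Finset.induction_on with
    | empty => exact fun _ => ⟨f, by simpa using h, fun _ _ => rfl, by simp⟩
    | insert u T hu ih =>
      intro hT
      obtain ⟨huS, hTS⟩ := Finset.insert_subset_iff.1 hT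
      obtain ⟨g, hg, hgf, hgQ⟩ := ih hTS
      by_cases huD : u ∈ D
      · refine ⟨g, ?_, hgf, ?_⟩
        · have : D ∪ ((insert u T : Finset V) : Set V) = D ∪ T := by
            ext t; simp only [Finset.coe_insert, Set.mem_union, Set.mem_insert_iff]; grind
          rwa [this]
        · intro t ht htD
          exact hgQ t ((Finset.mem_insert.1 ht).resolve_left (fun e => htD (e ▸ huD))) htD
      · obtain ⟨b, hb, hext⟩ := step (D ∪ T) g hg Set.subset_union_left
          (Set.union_subset_union_right _ (by exact_mod_cast hTS)) hgf
          (fun t ht htD => hgQ t (ht.resolve_left htD) htD) u huS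
          (fun hmem => hmem.elim huD hu)
        refine ⟨Function.update g u b, ?_, ?_, ?_⟩
        · have : D ∪ ((insert u T : Finset V) : Set V) = insert u (D ∪ T) := by
            ext t; simp only [Finset.coe_insert, Set.mem_union, Set.mem_insert_iff]; grind
          rwa [this]
        · intro t ht
          have htu : t ≠ u := fun e => huD (e ▸ ht)
          rw [Function.update_of_ne htu, hgf t ht]
        · intro t ht htD
          by_cases htu : t = u
          · subst htu; simpa using hb
          · rw [Function.update_of_ne htu]
            exact hgQ t ((Finset.mem_insert.1 ht).resolve_left htu) htD
  exact main S subset_rfl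

end IsPartialPCF

end Basic

section Ears

variable {V : Type*} {c : ℕ} {G : SimpleGraph V} {v : V}

/-- In a critical graph, no set `C` of vertices of degree two whose neighbors lie in
`C ∪ {v}` can be recolored at will, when `v` has a neighbor outside `C`. -/
theorem PCFCritical.false_of_ear (hG : PCFCritical G c) (hc : 0 < c) (C : Set V) (hv : v ∉ C)
    (hC : C.Nonempty) (hout : ∃ u ∉ C, G.Adj v u)
    (hcol : ∀ a α : Fin c, a ≠ α → ∃ h : V → Fin c, h v = a ∧ ∀ p ∈ C,
      (G.Adj p v → h p ≠ α) ∧ ∃ m n, HasNbrPair G p m n ∧ (m ∈ C ∨ m = v) ∧ (n ∈ C ∨ n = v) ∧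
        h m ≠ h n ∧ h p ≠ h m ∧ h p ≠ h n) : False := by
  classical
  obtain ⟨f, hf, hcf⟩ := hG.exists_coloring (D := Cᶜ) hc (by simpa using hC.ne_empty)
  obtain ⟨r, hr, hvr, huniq⟩ := hcf v hv hout
  obtain ⟨h, hhv, hh⟩ := hcol (f v) (f r) (hf v hv r hr hvr)
  set g : V → Fin c := fun t => if t ∈ C then h t else f t with hg
  have gC : ∀ t, t ∈ C ∨ t = v → g t = h t := by
    rintro t (ht | rfl)
    · simp [hg, ht]
    · simp [hg, hv, hhv]
  have gD : ∀ t, t ∉ C → g t = f t := fun t ht => by simp [hg, ht]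
  have hprop : ∀ p ∈ C, ∀ t, G.Adj p t → g p ≠ g t := by
    intro p hp t hpt
    obtain ⟨-, m, n, hN, hm, hn, -, hpm, hpn⟩ := hh p hp
    rcases (hN.2 t).1 hpt with rfl | rfl
    · rwa [gC p (Or.inl hp), gC _ hm]
    · rwa [gC p (Or.inl hp), gC _ hn]
  have hnbr : ∀ p ∈ C, ∀ t, G.Adj p t → t ∈ C ∨ t = v := by
    intro p hp t hpt
    obtain ⟨-, m, n, hN, hm, hn, -⟩ := hh p hp
    rcases (hN.2 t).1 hpt with rfl | rfl <;> assumption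
  refine hG.1 ⟨g, ?_, ?_⟩
  · intro p q hpq
    by_cases hp : p ∈ C
    · exact hprop p hp q hpq
    by_cases hq : q ∈ C
    · exact (hprop q hq p hpq.symm).symm
    rw [gD p hp, gD q hq]
    exact hf p hp q hq hpq
  · rintro p ⟨s, hps⟩
    by_cases hp : p ∈ C
    · obtain ⟨-, m, n, hN, hm, hn, hmn, -⟩ := hh p hp
      refine ⟨m, hN.left, fun t hpt htm => ?_⟩
      rcases (hN.2 t).1 hpt with rfl | rfl
      · rfl
      · rw [gC _ hm, gC _ hn] at htm
        exact absurd htm.symm hmn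
    · by_cases hpv : p = v
      · subst hpv
        refine ⟨r, hvr, fun t hpt htr => ?_⟩
        rw [gD r hr] at htr
        by_cases ht : t ∈ C
        · rw [gC t (Or.inl ht)] at htr
          exact absurd htr ((hh t ht).1 hpt.symm)
        · rw [gD t ht] at htr
          exact huniq t ht hpt htr
      · have hout' : ∀ t, G.Adj p t → t ∉ C := fun t hpt ht =>
          (hnbr t ht p hpt.symm).elim hp hpv
        obtain ⟨q, hq, hpq, hqu⟩ := hcf p hp ⟨s, hout' s hps, hps⟩
        refine ⟨q, hpq, fun t hpt htq => ?_⟩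
        rw [gD q hq, gD t (hout' t hpt)] at htq
        exact hqu t (hout' t hpt) hpt htq

theorem exists_adj_ne_ne [Fintype V] [DecidableRel G.Adj] (hd : 3 ≤ G.degree v) (p q : V) :
    ∃ u, G.Adj v u ∧ u ≠ p ∧ u ≠ q := by
  classical
  rw [← SimpleGraph.card_neighborFinset_eq_degree] at hd
  obtain ⟨u, hu, hu'⟩ := Finset.exists_mem_notMem_of_card_lt_card
    (s := {p, q}) (t := G.neighborFinset v) (lt_of_le_of_lt Finset.card_le_two (by omega))
  exact ⟨u, by simpa using hu, by simpa using hu'⟩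

theorem HasNbrPair.ne_of_three_le_degree [Fintype V] [DecidableRel G.Adj] {p m n : V}
    (h : HasNbrPair G p m n) (hd : 3 ≤ G.degree v) : p ≠ v := by
  rintro rfl
  obtain ⟨u, hu, hm, hn⟩ := exists_adj_ne_ne hd m n
  exact ((h.2 u).1 hu).elim hm hn

theorem exists_two_colors (hc : 4 ≤ c) (a α : Fin c) :
    ∃ b b' : Fin c, b ≠ a ∧ b ≠ α ∧ b' ≠ a ∧ b' ≠ α ∧ b' ≠ b := by
  obtain ⟨b, hba, hbα, -⟩ := exists_color_avoiding_three hc a α α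
  obtain ⟨b', hb'a, hb'α, hb'b⟩ := exists_color_avoiding_three hc a α b
  exact ⟨b, b', hba, hbα, hb'a, hb'α, hb'b⟩

variable [Fintype V] [DecidableRel G.Adj]

theorem PCFCritical.false_of_cycle_three (hG : PCFCritical G c) (hc : 4 ≤ c)
    (hd : 3 ≤ G.degree v) {p q : V} (hp : HasNbrPair G p v q) (hq : HasNbrPair G q p v) :
    False := by
  classical
  have hpv := hp.ne_of_three_le_degree hd
  have hqv := hq.ne_of_three_le_degree hd
  have hpq := hp.right.ne
  obtain ⟨u, hvu, hup, huq⟩ := exists_adj_ne_ne hd p q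
  refine hG.false_of_ear (by omega) {p, q} (by grind) ⟨p, by simp⟩ ⟨u, by grind, hvu⟩ ?_
  intro a α haα
  obtain ⟨b, b', hba, hbα, hb'a, hb'α, hb'b⟩ := exists_two_colors hc a α
  refine ⟨fun t => if t = p then b else if t = q then b' else a, by grind, ?_⟩
  rintro t (rfl | rfl)
  · exact ⟨by grind, _, _, hp, by grind, by grind, by grind, by grind, by grind⟩
  · exact ⟨by grind, _, _, hq, by grind, by grind, by grind, by grind, by grind⟩

theorem PCFCritical.false_of_cycle_four (hG : PCFCritical G c) (hc : 4 ≤ c)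
    (hd : 3 ≤ G.degree v) {p q r : V} (hp : HasNbrPair G p v q) (hq : HasNbrPair G q p r)
    (hr : HasNbrPair G r q v) : False := by
  classical
  have hpv := hp.ne_of_three_le_degree hd
  have hqv := hq.ne_of_three_le_degree hd
  have hrv := hr.ne_of_three_le_degree hd
  have hpq := hp.right.ne
  have hqr := hq.right.ne
  have hpr := hq.1
  obtain ⟨u, hvu, hup, hur⟩ := exists_adj_ne_ne hd p r
  have huq : u ≠ q := by
    rintro rfl
    have := (hq.2 v).1 hvu.symm
    grind
  refine hG.false_of_ear (by omega) {p, q, r} (by grind) ⟨p, by simp⟩ ⟨u, by grind, hvu⟩ ?_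
  intro a α haα
  obtain ⟨b, b', hba, hbα, hb'a, hb'α, hb'b⟩ := exists_two_colors hc a α
  have hnq : ¬ G.Adj q v := fun h => by have := (hq.2 v).1 h; grind
  refine ⟨fun t => if t = p then b else if t = q then α else if t = r then b' else a,
    by grind, ?_⟩
  rintro t (rfl | rfl | rfl)
  · exact ⟨by grind, _, _, hp, by grind, by grind, by grind, by grind, by grind⟩
  · exact ⟨by grind, _, _, hq, by grind, by grind, by grind, by grind, by grind⟩
  · exact ⟨by grind, _, _, hr, by grind, by grind, by grind, by grind, by grind⟩

theorem PCFCritical.false_of_cycle_five (hG : PCFCritical G c) (hc : 4 ≤ c)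
    (hd : 3 ≤ G.degree v) {p q r s : V} (hp : HasNbrPair G p v q) (hq : HasNbrPair G q p r)
    (hr : HasNbrPair G r q s) (hs : HasNbrPair G s r v) : False := by
  classical
  have hpv := hp.ne_of_three_le_degree hd
  have hqv := hq.ne_of_three_le_degree hd
  have hrv := hr.ne_of_three_le_degree hd
  have hsv := hs.ne_of_three_le_degree hd
  have hpq := hp.right.ne
  have hqr := hq.right.ne
  have hrs := hr.right.ne
  have hpr := hq.1
  have hqs := hr.1
  have hnq : ¬ G.Adj q v := fun h => by have := (hq.2 v).1 h; grind
  have hnr : ¬ G.Adj r v := fun h => by have := (hr.2 v).1 h; grind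
  have hps : p ≠ s := by
    rintro rfl
    have := (hs.2 q).1 hp.right
    grind
  obtain ⟨u, hvu, hup, hus⟩ := exists_adj_ne_ne hd p s
  have huq : u ≠ q := by rintro rfl; exact hnq hvu.symm
  have hur : u ≠ r := by rintro rfl; exact hnr hvu.symm
  refine hG.false_of_ear (by omega) {p, q, r, s} (by grind) ⟨p, by simp⟩ ⟨u, by grind, hvu⟩ ?_
  intro a α haα
  obtain ⟨b, b', hba, hbα, hb'a, hb'α, hb'b⟩ := exists_two_colors hc a α
  refine ⟨fun t => if t = p then b else if t = q then b' else if t = r then α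
    else if t = s then b else a, by grind, ?_⟩
  rintro t (rfl | rfl | rfl | rfl)
  · exact ⟨by grind, _, _, hp, by grind, by grind, by grind, by grind, by grind⟩
  · exact ⟨by grind, _, _, hq, by grind, by grind, by grind, by grind, by grind⟩
  · exact ⟨by grind, _, _, hr, by grind, by grind, by grind, by grind, by grind⟩
  · exact ⟨by grind, _, _, hs, by grind, by grind, by grind, by grind, by grind⟩

theorem PCFCritical.false_of_cycle_six (hG : PCFCritical G c) (hc : 4 ≤ c)
    (hd : 3 ≤ G.degree v) {p q r s t : V} (hp : HasNbrPair G p v q) (hq : HasNbrPair G q p r)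
    (hr : HasNbrPair G r q s) (hs : HasNbrPair G s r t) (ht : HasNbrPair G t s v) : False := by
  classical
  have hpv := hp.ne_of_three_le_degree hd
  have hqv := hq.ne_of_three_le_degree hd
  have hrv := hr.ne_of_three_le_degree hd
  have hsv := hs.ne_of_three_le_degree hd
  have htv := ht.ne_of_three_le_degree hd
  have hpq := hp.right.ne
  have hqr := hq.right.ne
  have hrs := hr.right.ne
  have hst := hs.right.ne
  have hpr := hq.1
  have hqs := hr.1
  have hrt := hs.1
  have hnq : ¬ G.Adj q v := fun h => by have := (hq.2 v).1 h; grind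
  have hnr : ¬ G.Adj r v := fun h => by have := (hr.2 v).1 h; grind
  have hns : ¬ G.Adj s v := fun h => by have := (hs.2 v).1 h; grind
  have hps : p ≠ s := by rintro rfl; exact hns hp.left
  have hqt : q ≠ t := by rintro rfl; exact hnq ht.right
  have hpt : p ≠ t := by
    rintro rfl
    have := (ht.2 q).1 hp.right
    grind
  obtain ⟨u, hvu, hup, hut⟩ := exists_adj_ne_ne hd p t
  have huq : u ≠ q := by rintro rfl; exact hnq hvu.symm
  have hur : u ≠ r := by rintro rfl; exact hnr hvu.symm
  have hus : u ≠ s := by rintro rfl; exact hns hvu.symm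
  refine hG.false_of_ear (by omega) {p, q, r, s, t} (by grind) ⟨p, by simp⟩
    ⟨u, by grind, hvu⟩ ?_
  intro a α haα
  obtain ⟨b, b', hba, hbα, hb'a, hb'α, hb'b⟩ := exists_two_colors hc a α
  refine ⟨fun x => if x = p then b else if x = q then b' else if x = r then a
    else if x = s then α else if x = t then b else a, by grind, ?_⟩
  rintro x (rfl | rfl | rfl | rfl | rfl)
  · exact ⟨by grind, _, _, hp, by grind, by grind, by grind, by grind, by grind⟩
  · exact ⟨by grind, _, _, hq, by grind, by grind, by grind, by grind, by grind⟩
  · exact ⟨by grind, _, _, hr, by grind, by grind, by grind, by grind, by grind⟩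
  · exact ⟨by grind, _, _, hs, by grind, by grind, by grind, by grind, by grind⟩
  · exact ⟨by grind, _, _, ht, by grind, by grind, by grind, by grind, by grind⟩

end Ears

section Completion

variable {V : Type*} {c : ℕ} {G : SimpleGraph V} {v : V} {D : Set V} {f : V → Fin c}

/-- Given at most four colored objects, one more object can be colored so that some color is
used exactly once, even when one color `a` is forbidden for the new object. -/
theorem exists_color_unique (hc : 4 ≤ c) (N : Finset V) (hN : N.card ≤ 4) (a : Fin c)
    (ha : ∀ t ∈ N, f t ≠ a) :
    ∃ b, b ≠ a ∧ ((∀ t ∈ N, f t ≠ b) ∨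
      ∃ s ∈ N, f s ≠ b ∧ ∀ t ∈ N, f t = f s → t = s) := by
  classical
  by_cases hunused : ∃ b, b ≠ a ∧ ∀ t ∈ N, f t ≠ b
  · obtain ⟨b, hba, hb⟩ := hunused
    exact ⟨b, hba, Or.inl hb⟩
  push Not at hunused
  by_cases huniq : ∃ s ∈ N, ∀ t ∈ N, f t = f s → t = s
  · obtain ⟨s, hs, hst⟩ := huniq
    obtain ⟨b, hba, hbs, -⟩ := exists_color_avoiding_three hc a (f s) a
    exact ⟨b, hba, Or.inr ⟨s, hs, hbs.symm, hst⟩⟩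
  push Not at huniq
  exfalso
  have hfib : ∀ b ∈ Finset.univ.erase a, 2 ≤ (N.filter (fun t => f t = b)).card := by
    intro b hb
    obtain ⟨s, hs, hsb⟩ := hunused b (Finset.ne_of_mem_erase hb)
    obtain ⟨t, ht, hts, hne⟩ := huniq s hs
    exact Finset.one_lt_card.2 ⟨t, by simp [ht, hts, hsb], s, by simp [hs, hsb], hne⟩
  have hsum := Finset.card_eq_sum_card_fiberwise (f := f) (s := N) (t := Finset.univ.erase a)
    (fun t ht => by simpa using ha t ht)
  have hle := Finset.card_nsmul_le_sum _ _ _ hfib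
  rw [← hsum, Finset.card_erase_of_mem (Finset.mem_univ a), Finset.card_univ,
    Fintype.card_fin, smul_eq_mul] at hle
  omega

/-- Adding the first vertex `x` of a thread at `v`, once all other neighbors of `v` are colored,
so that the conflict-free condition holds at `v`. -/
theorem IsPartialPCF.exists_insert_first [Fintype V] [DecidableEq V] [DecidableRel G.Adj]
    (hc : 4 ≤ c) (hd : G.degree v ≤ 5) (h : IsPartialPCF G v D f) {x y : V} (hx : HasNbrPair G x v y)
    (hxD : x ∉ D) (hyD : y ∉ D) (hvD : v ∈ D) (hN : ∀ t, G.Adj v t → t ≠ x → t ∈ D) :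
    ∃ b, b ≠ f v ∧ IsPartialPCF G v (insert x D) (Function.update f x b) ∧
      ∃ s, G.Adj v s ∧ ∀ t, G.Adj v t →
        Function.update f x b t = Function.update f x b s → t = s := by
  have hvx : x ∈ G.neighborFinset v := by simpa using hx.left.symm
  obtain ⟨b, hba, hb⟩ := exists_color_unique (f := f) hc ((G.neighborFinset v).erase x)
    (by rw [Finset.card_erase_of_mem hvx, SimpleGraph.card_neighborFinset_eq_degree]; omega)
    (f v) (fun t ht => by
      rw [Finset.mem_erase, SimpleGraph.mem_neighborFinset] at ht
      exact h.1 t (hN t ht.2 ht.1) v hvD ht.2.symm)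
  simp only [Finset.mem_erase, SimpleGraph.mem_neighborFinset] at hb
  have honly : ∀ w ∈ D, G.Adj x w → w = v := fun w hw hxw =>
    ((hx.2 w).1 hxw).resolve_right (fun e => hyD (e ▸ hw))
  refine ⟨b, hba, h.insert_update hxD ?_ ?_ ?_, ?_⟩
  · intro w hw hxw
    rw [honly w hw hxw]; exact hba.symm
  · exact fun w hw hxw hwv => absurd (honly w hw hxw) hwv
  · rintro - ⟨s, hs, hxs⟩
    exact ⟨s, hs, hxs, fun t ht hxt _ => (honly t ht hxt).trans (honly s hs hxs).symm⟩
  · rcases hb with hb | ⟨s, ⟨hsx, hvs⟩, hsb, hs⟩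
    · refine ⟨x, hx.left.symm, fun t hvt hts => ?_⟩
      by_contra htx
      rw [Function.update_self, Function.update_of_ne htx] at hts
      exact hb t ⟨htx, hvt⟩ hts
    · refine ⟨s, hvs, fun t hvt hts => ?_⟩
      rw [Function.update_of_ne hsx] at hts
      by_cases htx : t = x
      · subst htx
        rw [Function.update_self] at hts
        exact absurd hts.symm hsb
      · rw [Function.update_of_ne htx] at hts
        exact hs t ⟨htx, hvt⟩ hts

/-- Adding the middle vertex `y` of a 3-thread `x, y, z`, the last uncolored vertex. -/
theorem IsPartialPCF.exists_pcf_of_middle [DecidableEq V] (hc : 4 ≤ c) {x y z w : V}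
    (h : IsPartialPCF G v {y}ᶜ f) (hx : HasNbrPair G x v y) (hy : HasNbrPair G y x z)
    (hz : HasNbrPair G z y w) (hcf : ∃ s, G.Adj v s ∧ ∀ t, G.Adj v t → f t = f s → t = s)
    (hxz : f x ≠ f z) (hcoin : f z = f v ∨ f w = f v) (hzv : z ≠ v) :
    ∃ g : V → Fin c, IsPCFColoring G g := by
  have hxy : x ∈ ({y}ᶜ : Set V) := hx.right.ne
  have hzy : z ∈ ({y}ᶜ : Set V) := hy.right.ne'
  have hvy : v ∈ ({y}ᶜ : Set V) := hx.1
  have hwy : w ∈ ({y}ᶜ : Set V) := hz.1.symm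
  have hnvy : ¬ G.Adj v y := fun e => by
    rcases (hy.2 v).1 e.symm with e' | e'
    · exact hx.left.ne e'.symm
    · exact hzv e'.symm
  obtain ⟨b, hbx, hbz, hbv, hbw⟩ : ∃ b, b ≠ f x ∧ b ≠ f z ∧ b ≠ f v ∧ b ≠ f w := by
    rcases hcoin with e | e
    · obtain ⟨b, h1, h2, h3⟩ := exists_color_avoiding_three hc (f x) (f z) (f w)
      exact ⟨b, h1, h2, e ▸ h2, h3⟩
    · obtain ⟨b, h1, h2, h3⟩ := exists_color_avoiding_three hc (f x) (f z) (f w)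
      exact ⟨b, h1, h2, e ▸ h3, h3⟩
  have hext : IsPartialPCF G v (insert y {y}ᶜ) (Function.update f y b) := by
    refine h.insert_update (by simp) ?_ ?_ ?_
    · intro t _ hyt
      rcases (hy.2 t).1 hyt with rfl | rfl
      exacts [hbx.symm, hbz.symm]
    · intro t _ hyt _ _
      rcases (hy.2 t).1 hyt with rfl | rfl
      · exact ⟨v, hvy, hx.left, hbv.symm,
          fun s hs hts _ => ((hx.2 s).1 hts).resolve_right hs⟩
      · exact ⟨w, hwy, hz.right, hbw.symm,
          fun s hs hts _ => ((hz.2 s).1 hts).resolve_left hs⟩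
    · rintro - -
      refine ⟨x, hxy, hy.left, fun t _ hyt htx => ?_⟩
      rcases (hy.2 t).1 hyt with rfl | rfl
      exacts [rfl, absurd htx.symm hxz]
  have huniv : (insert y {y}ᶜ : Set V) = Set.univ := by ext t; simp [em]
  rw [huniv] at hext
  refine ⟨_, fun p q hpq => hext.1 p trivial q trivial hpq, fun p hp => ?_⟩
  by_cases hpv : p = v
  · subst hpv
    obtain ⟨s, hps, hs⟩ := hcf
    have hne : ∀ t, G.Adj p t → t ≠ y := fun t hpt e => hnvy (e ▸ hpt)
    refine ⟨s, hps, fun t hpt hts => hs t hpt ?_⟩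
    rwa [Function.update_of_ne (hne t hpt), Function.update_of_ne (hne s hps)] at hts
  · obtain ⟨s, -, hps, hs⟩ := hext.2 p trivial hpv (hp.imp fun t ht => ⟨trivial, ht⟩)
    exact ⟨s, hps, fun t hpt => hs t trivial hpt⟩

/-- A partial coloring missing only a 3-thread `x, y, z` at `v` (or only `x, y`, with `z` and `v`
of the same color) can be completed. -/
theorem IsPartialPCF.exists_pcf_of_threeThread [Fintype V] [DecidableEq V] [DecidableRel G.Adj]
    (hc : 4 ≤ c) (hd : G.degree v ≤ 5) (h : IsPartialPCF G v D f) {x y z w : V}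
    (hx : HasNbrPair G x v y) (hy : HasNbrPair G y x z) (hz : HasNbrPair G z y w)
    (hzv : z ≠ v) (hvz : ¬ G.Adj v z) (hwv : w ≠ v)
    (hD : D = {x, y}ᶜ ∧ f z = f v ∨ D = {x, y, z}ᶜ ∧ f w = f v) :
    ∃ g : V → Fin c, IsPCFColoring G g := by
  have hxy := hx.right.ne
  have hyz := hy.right.ne
  have hxz : x ≠ z := hy.1
  have hvx := hx.left.ne
  have hvy := hx.1
  have hzw := hz.right.ne
  have hyw := hz.1
  have hnvy : ¬ G.Adj v y := fun e => by
    rcases (hy.2 v).1 e.symm with e' | e'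
    · exact hx.left.ne e'.symm
    · exact hzv e'.symm
  have hxw : x ≠ w := by
    rintro rfl
    rcases (hx.2 z).1 hz.right.symm with e | e
    exacts [hzv e, hyz e.symm]
  rcases hD with ⟨rfl, hzc⟩ | ⟨rfl, hwc⟩
  · obtain ⟨b, hbv, hb, hcf⟩ := h.exists_insert_first hc hd hx (by simp) (by simp)
      (by grind) (by grind)
    have hset : (insert x {x, y}ᶜ : Set V) = {y}ᶜ := by ext t; simp; grind
    rw [hset] at hb
    refine hb.exists_pcf_of_middle hc hx hy hz hcf ?_ (Or.inl ?_) hzv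
    · rw [Function.update_self, Function.update_of_ne hxz.symm, hzc]; exact hbv
    · rw [Function.update_of_ne hxz.symm, Function.update_of_ne hvx.symm, hzc]
  · obtain ⟨b, hbv, hb, hcf⟩ := h.exists_insert_first hc hd hx (by simp) (by simp)
      (by grind) (by grind)
    set g := Function.update f x b with hg
    have hset : (insert x {x, y, z}ᶜ : Set V) = {y, z}ᶜ := by ext t; simp; grind
    rw [hset] at hb
    have hwD : w ∈ ({y, z}ᶜ : Set V) := by grind
    obtain ⟨α, hα⟩ := hb.exists_conflictFreeAvoiding hwD hwv
    obtain ⟨e, hew, heα, hex⟩ := exists_color_avoiding_three hc (g w) α (g x)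
    have honly : ∀ t ∈ ({y, z}ᶜ : Set V), G.Adj z t → t = w := fun t ht hzt =>
      ((hz.2 t).1 hzt).resolve_left (by grind)
    have hext : IsPartialPCF G v (insert z {y, z}ᶜ) (Function.update g z e) := by
      refine hb.insert_update (by simp) ?_ ?_ ?_
      · intro t ht hzt
        rw [honly t ht hzt]; exact hew.symm
      · intro t ht hzt _
        rw [honly t ht hzt]; exact hα e heα
      · rintro - -
        exact ⟨w, hwD, hz.right, fun t ht hzt _ => honly t ht hzt⟩
    have hset' : (insert z {y, z}ᶜ : Set V) = {y}ᶜ := by ext t; simp; grind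
    rw [hset'] at hext
    refine hext.exists_pcf_of_middle hc hx hy hz ?_ ?_ (Or.inr ?_) hzv
    · obtain ⟨s, hvs, hs⟩ := hcf
      have hne : ∀ t, G.Adj v t → t ≠ z := fun t hvt e => hvz (e ▸ hvt)
      refine ⟨s, hvs, fun t hvt hts => hs t hvt ?_⟩
      rwa [Function.update_of_ne (hne t hvt), Function.update_of_ne (hne s hvs)] at hts
    · rw [Function.update_self, Function.update_of_ne hxz]; exact hex.symm
    · rw [Function.update_of_ne hzw.symm, Function.update_of_ne hzv.symm, hg,
        Function.update_of_ne hxw.symm, Function.update_of_ne hvx.symm, hwc]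

end Completion

section Threads

variable {V : Type*} {c : ℕ} {G : SimpleGraph V} {v : V} {D : Set V} {f : V → Fin c}

/-- Extending a partial coloring to second vertices of threads, avoiding the color of `v`. -/
theorem IsPartialPCF.exists_extension_second [Finite V] (hc : 4 ≤ c) (h : IsPartialPCF G v D f)
    (S : Set V)
    (hS : ∀ y ∈ S, y ∉ D → ∃ x w, HasNbrPair G y x w ∧ w ∈ D ∧ w ≠ v ∧ x ∉ D ∧ x ∉ S) :
    ∃ g : V → Fin c, IsPartialPCF G v (D ∪ S) g ∧ (∀ t ∈ D, g t = f t) ∧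
      ∀ y ∈ S, y ∉ D → g y ≠ f v := by
  classical
  have := h.exists_extension S.toFinite.toFinset (fun _ b => b ≠ f v) ?_
  · simpa using this
  simp only [Set.Finite.coe_toFinset, Set.Finite.mem_toFinset]
  intro E g hg hDE hES _ _ y hy hyE
  obtain ⟨x, w, hN, hw, hwv, hxD, hxS⟩ := hS y hy (fun h' => hyE (hDE h'))
  have honly : ∀ t ∈ E, G.Adj y t → t = w := fun t ht hyt =>
    ((hN.2 t).1 hyt).resolve_left (fun e => (hES (e ▸ ht)).elim hxD hxS)
  obtain ⟨α, hα⟩ := hg.exists_conflictFreeAvoiding (hDE hw) hwv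
  obtain ⟨b, hbw, hbα, hbv⟩ := exists_color_avoiding_three hc (g w) α (f v)
  refine ⟨b, hbv, hg.insert_update hyE ?_ ?_ ?_⟩
  · intro t ht hyt
    rw [honly t ht hyt]; exact hbw.symm
  · intro t ht hyt _
    rw [honly t ht hyt]; exact hα b hbα
  · rintro - -
    exact ⟨w, hDE hw, hN.right, fun t ht hyt _ => honly t ht hyt⟩

/-- Extending a partial coloring to neighbors of `v` of degree at most two. -/
theorem IsPartialPCF.exists_extension_first [Finite V] (hc : 4 ≤ c) (h : IsPartialPCF G v D f)
    (S : Set V) (hv : v ∈ D)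
    (hS : ∀ u ∈ S, u ∉ D →
      (∀ t, G.Adj u t → t = v) ∨ ∃ s ∈ D, HasNbrPair G u v s ∧ f s ≠ f v) :
    ∃ g : V → Fin c, IsPartialPCF G v (D ∪ S) g ∧ ∀ t ∈ D, g t = f t := by
  classical
  have := h.exists_extension S.toFinite.toFinset (fun _ _ => True) ?_
  · simpa using this
  simp only [Set.Finite.coe_toFinset, Set.Finite.mem_toFinset]
  intro E g hg hDE hES hgf _ u hu huE
  rcases hS u hu (fun h' => huE (hDE h')) with honly | ⟨s, hs, hN, hsv⟩
  · obtain ⟨b, hbv, -⟩ := exists_color_avoiding_three hc (g v) (g v) (g v)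
    refine ⟨b, trivial, hg.insert_update huE ?_ ?_ ?_⟩
    · intro t _ hut
      rw [honly t hut]; exact hbv.symm
    · exact fun t _ hut htv => absurd (honly t hut) htv
    · rintro - ⟨t, ht, hut⟩
      exact ⟨t, ht, hut, fun r _ hur _ => (honly r hur).trans (honly t hut).symm⟩
  · have hsv' : g s ≠ g v := by rwa [hgf s hs, hgf v hv]
    obtain ⟨α, hα⟩ := hg.exists_conflictFreeAvoiding (hDE hs) hN.1.symm
    obtain ⟨b, hbv, hbs, hbα⟩ := exists_color_avoiding_three hc (g v) (g s) α
    refine ⟨b, trivial, hg.insert_update huE ?_ ?_ ?_⟩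
    · intro t _ hut
      rcases (hN.2 t).1 hut with rfl | rfl
      exacts [hbv.symm, hbs.symm]
    · intro t _ hut htv
      rw [((hN.2 t).1 hut).resolve_left htv]; exact hα b hbα
    · rintro - -
      refine ⟨v, hDE hv, hN.left, fun t _ hut htv => ?_⟩
      rcases (hN.2 t).1 hut with rfl | rfl
      exacts [rfl, absurd htv hsv']

theorem HasNbrPair.of_adj {p a b t : V} (h : HasNbrPair G p a b) (ht : G.Adj p t) (hta : t ≠ a) :
    HasNbrPair G p t a := by
  have := ((h.2 t).1 ht).resolve_left hta
  subst this
  exact h.swap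

theorem HasNbrPair.degree_eq_two [Fintype V] [DecidableRel G.Adj] {p a b : V}
    (h : HasNbrPair G p a b) : G.degree p = 2 := by
  classical
  rw [← SimpleGraph.card_neighborFinset_eq_degree, Finset.card_eq_two]
  exact ⟨a, b, h.1, by ext t; simp [h.2 t]⟩

theorem HasNbrPair.of_degree_le_two [Fintype V] [DecidableRel G.Adj] {p a b : V}
    (hp : G.degree p ≤ 2) (ha : G.Adj p a) (hb : G.Adj p b) (hab : a ≠ b) :
    HasNbrPair G p a b := by
  classical
  have hsub : ({a, b} : Finset V) ⊆ G.neighborFinset p := by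
    intro t ht
    rcases Finset.mem_insert.1 ht with rfl | ht
    · simpa using ha
    · rw [Finset.mem_singleton] at ht; subst ht; simpa using hb
  have heq := Finset.eq_of_subset_of_card_le hsub (by
    rw [SimpleGraph.card_neighborFinset_eq_degree, Finset.card_pair hab]; exact hp)
  exact ⟨hab, fun t => by rw [← SimpleGraph.mem_neighborFinset, ← heq]; simp⟩

/-- The neighbors of `v` of degree at most two. -/
def lowNbrs [Fintype V] (G : SimpleGraph V) [DecidableRel G.Adj] (v : V) : Set V :=
  {u | G.Adj v u ∧ G.degree u ≤ 2}

/-- The second vertices of the 2-threads adjacent to `v`. -/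
def secondVerts (G : SimpleGraph V) (v : V) : Set V :=
  {y | ∃ x w, HasNbrPair G x v y ∧ HasNbrPair G y x w}

variable [Fintype V] [DecidableRel G.Adj]

namespace PCFCritical

theorem not_adj_of_mem_secondVerts (hG : PCFCritical G c) (hc : 4 ≤ c) (hd : 3 ≤ G.degree v)
    {y : V} (hy : y ∈ secondVerts G v) : ¬ G.Adj v y := by
  obtain ⟨x, w, hx, hyN⟩ := hy
  exact fun hvy => hG.false_of_cycle_three hc hd hx (hyN.of_adj hvy.symm hx.left.ne').swap

theorem end_of_twoThread (hG : PCFCritical G c) (hc : 4 ≤ c) (hd : 3 ≤ G.degree v)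
    {x y w : V} (hx : HasNbrPair G x v y) (hy : HasNbrPair G y x w) :
    w ≠ v ∧ w ∉ lowNbrs G v ∧ w ∉ secondVerts G v := by
  have hyv : ¬ G.Adj v y := hG.not_adj_of_mem_secondVerts hc hd ⟨x, w, hx, hy⟩
  refine ⟨?_, ?_, ?_⟩
  · rintro rfl
    exact hyv hy.right.symm
  · rintro ⟨hvw, hw⟩
    exact hG.false_of_cycle_four hc hd hx hy
      (.of_degree_le_two hw hy.right.symm hvw.symm hx.1.symm)
  · rintro ⟨x', w', hx', hw⟩
    have hyx' : y ≠ x' := by rintro rfl; exact hyv hx'.left.symm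
    exact hG.false_of_cycle_five hc hd hx hy (hw.of_adj hy.right.symm hyx') hx'.swap

theorem end_of_threeThread (hG : PCFCritical G c) (hc : 4 ≤ c) (hd : 3 ≤ G.degree v)
    {x y z w : V} (hx : HasNbrPair G x v y) (hy : HasNbrPair G y x z) (hz : HasNbrPair G z y w) :
    ¬ G.Adj v z ∧ z ∉ secondVerts G v ∧ w ≠ v ∧ w ∉ lowNbrs G v ∧ w ∉ secondVerts G v := by
  obtain ⟨hzv, hzL, hzY⟩ := hG.end_of_twoThread hc hd hx hy
  have hvz : ¬ G.Adj v z := fun h => hzL ⟨h, hz.degree_eq_two.le⟩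
  refine ⟨hvz, hzY, ?_, ?_, ?_⟩
  · rintro rfl
    exact hvz hz.right.symm
  · rintro ⟨hvw, hw⟩
    exact hG.false_of_cycle_five hc hd hx hy hz
      (.of_degree_le_two hw hz.right.symm hvw.symm hzv)
  · rintro ⟨x', w', hx', hw⟩
    have hzx' : z ≠ x' := by rintro rfl; exact hvz hx'.left.symm
    exact hG.false_of_cycle_six hc hd hx hy hz (hw.of_adj hz.right.symm hzx') hx'.swap

end PCFCritical

end Threads

section Core

variable {V : Type*} {c : ℕ} {G : SimpleGraph V} {v : V}

/-- What remains of the graph after removing `v`, its neighbors of degree at most two, the second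
vertices of its 2-threads, and the vertex `z`. -/
def outerVerts [Fintype V] (G : SimpleGraph V) [DecidableRel G.Adj] (v z : V) : Set V :=
  {u | u ≠ v ∧ u ∉ lowNbrs G v ∧ u ∉ secondVerts G v ∧ u ≠ z}

variable [Fintype V] [DecidableRel G.Adj]

theorem three_le_degree_of_notMem_lowNbrs {u : V} (hvu : G.Adj v u) (hu : u ∉ lowNbrs G v) :
    3 ≤ G.degree u := by
  by_contra hlt
  exact hu ⟨hvu, by omega⟩

/-- The outer vertices, together with at most one further vertex `q`, can be colored in such a way
that the end `w` of the 3-thread has a colored neighbor whenever it is adjacent to `v`. -/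
theorem PCFCritical.exists_outer_coloring (hG : PCFCritical G c) (hc : 4 ≤ c)
    (hd : 3 ≤ G.degree v) {x y z w : V} (hx : HasNbrPair G x v y) (hy : HasNbrPair G y x z)
    (hz : HasNbrPair G z y w) :
    ∃ (R : Set V) (f : V → Fin c), IsPartialPCF G v R f ∧ outerVerts G v z ⊆ R ∧
      v ∉ R ∧ x ∉ R ∧ y ∉ R ∧ z ∉ R ∧ (G.Adj v w → ∃ s ∈ R, G.Adj w s) ∧
      ∀ q ∈ R, q ∉ outerVerts G v z → G.Adj v w ∧ G.Adj w q ∧ (∀ s ∈ R, G.Adj w s → s = q) ∧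
        ∃ m ∉ R, HasNbrPair G q m w := by
  classical
  obtain ⟨hvz, hzY, hwv, hwL, hwY⟩ := hG.end_of_threeThread hc hd hx hy hz
  have hw : w ∈ outerVerts G v z := ⟨hwv, hwL, hwY, hz.right.ne'⟩
  have hv : v ∉ outerVerts G v z := fun h => h.1 rfl
  have hxO : x ∉ outerVerts G v z := fun h => h.2.1 ⟨hx.left.symm, hx.degree_eq_two.le⟩
  have hyO : y ∉ outerVerts G v z := fun h => h.2.2.1 ⟨x, z, hx, hy⟩
  have hzO : z ∉ outerVerts G v z := fun h => h.2.2.2 rfl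
  obtain ⟨f, hf, hcf⟩ := hG.exists_coloring (D := outerVerts G v z) (by omega)
    (fun h => hv (h ▸ Set.mem_univ v))
  have hpart : IsPartialPCF G v (outerVerts G v z) f := ⟨hf, fun u hu _ => hcf u hu⟩
  by_cases hiso : G.Adj v w → ∃ s ∈ outerVerts G v z, G.Adj w s
  · exact ⟨_, f, hpart, subset_rfl, hv, hxO, hyO, hzO, hiso, fun q hq hq' => absurd hq hq'⟩
  push Not at hiso
  obtain ⟨hvw, hiso⟩ := hiso
  obtain ⟨q, hwq, hqv, hqz⟩ :=
    exists_adj_ne_ne (three_le_degree_of_notMem_lowNbrs hvw hwL) v z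
  have hqO : q ∉ outerVerts G v z := fun h => hiso q h hwq
  have hwx : w ≠ x := fun e => hwL (e ▸ ⟨hx.left.symm, hx.degree_eq_two.le⟩)
  have hqx : q ≠ x := by
    rintro rfl
    exact ((hx.2 w).1 hwq.symm).elim hwv hz.1.symm
  have hqy : q ≠ y := by
    rintro rfl
    exact ((hy.2 w).1 hwq.symm).elim hwx hz.right.ne'
  obtain ⟨m, hmO, hqN⟩ : ∃ m ∉ outerVerts G v z, HasNbrPair G q m w := by
    by_cases hqL : q ∈ lowNbrs G v
    · exact ⟨v, hv, .of_degree_le_two hqL.2 hqL.1.symm hwq.symm hwv.symm⟩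
    · obtain ⟨x', w', hx', hq⟩ : q ∈ secondVerts G v := by
        by_contra hqY
        exact hqO ⟨hqv, hqL, hqY, hqz⟩
      have hx'L : x' ∈ lowNbrs G v := ⟨hx'.left.symm, hx'.degree_eq_two.le⟩
      exact ⟨x', fun h => h.2.1 hx'L,
        (hq.of_adj hwq.symm (fun e => hwL (e ▸ hx'L))).swap⟩
  have honly : ∀ t ∈ outerVerts G v z, G.Adj q t → t = w := fun t ht hqt =>
    ((hqN.2 t).1 hqt).resolve_left (fun e => hmO (e ▸ ht))
  obtain ⟨b, hbw, -⟩ := exists_color_avoiding_three hc (f w) (f w) (f w)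
  refine ⟨insert q (outerVerts G v z), Function.update f q b, hpart.insert_update hqO ?_ ?_ ?_,
    Set.subset_insert _ _, ?_, ?_, ?_, ?_, ?_, ?_⟩
  · intro t ht hqt
    rw [honly t ht hqt]; exact hbw.symm
  · rintro t ht hqt - ⟨s, hs, hts⟩
    rw [honly t ht hqt] at hts
    exact absurd hts (hiso s hs)
  · rintro - -
    exact ⟨w, hw, hqN.right, fun t ht hqt _ => honly t ht hqt⟩
  · exact fun h => h.elim hqv.symm hv
  · exact fun h => h.elim hqx.symm hxO
  · exact fun h => h.elim hqy.symm hyO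
  · exact fun h => h.elim hqz.symm hzO
  · exact fun _ => ⟨q, Or.inl rfl, hwq⟩
  · rintro r (rfl | hr) hr'
    · refine ⟨hvw, hwq, ?_, m, fun h => h.elim hqN.left.ne' hmO, hqN⟩
      rintro s (rfl | hs) hws
      exacts [rfl, absurd hws (hiso s hs)]
    · exact absurd hr hr'

/-- The choice of the color of `v`: a neighbor starting a 2-thread forbids no color, any other
neighbor of degree at most two forbids one, and a neighbor of larger degree forbids two. -/
theorem IsPartialPCF.exists_center_color (hc : 4 ≤ c) {R : Set V} {f : V → Fin c}
    (h : IsPartialPCF G v R f) (hv : v ∉ R) (α : Fin c)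
    (hcount : G.degree v + {u | G.Adj v u ∧ 3 ≤ G.degree u}.ncard ≤
      {x | G.Adj v x ∧ G.degree x = 2 ∧ ∃ y, G.Adj x y ∧ y ≠ v ∧ G.degree y = 2}.ncard + 2) :
    ∃ a, a ≠ α ∧
      (∀ u ∈ R, G.Adj v u → 3 ≤ G.degree u → f u ≠ a ∧ ConflictFreeAvoiding G R f u a) ∧
      ∀ u s, HasNbrPair G u v s → s ∉ secondVerts G v → f s ≠ a := by
  classical
  set T : Set V := {x | G.Adj v x ∧ G.degree x = 2 ∧ ∃ y, G.Adj x y ∧ y ≠ v ∧ G.degree y = 2}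
    with hT
  have hforb : ∀ u ∈ G.neighborFinset v, ∃ F : Finset (Fin c),
      F.card + (if u ∈ T then 1 else 0) ≤ 1 + (if 3 ≤ G.degree u then 1 else 0) ∧
      ∀ a ∉ F,
        (u ∈ R → 3 ≤ G.degree u → f u ≠ a ∧ ConflictFreeAvoiding G R f u a) ∧
        ∀ s, HasNbrPair G u v s → s ∉ secondVerts G v → f s ≠ a := by
    intro u hu
    by_cases hdeg : 3 ≤ G.degree u
    · have huT : u ∉ T := fun h => by have := h.2.1; omega
      have hno : ∀ s, ¬ HasNbrPair G u v s := fun s hs => by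
        have := hs.degree_eq_two
        omega
      by_cases huR : u ∈ R
      · obtain ⟨β, hβ⟩ := h.exists_conflictFreeAvoiding huR (fun e => hv (e ▸ huR))
        refine ⟨{f u, β}, ?_, fun a ha => ⟨fun _ _ => ?_, fun s hs => absurd hs (hno s)⟩⟩
        · simpa [huT, hdeg] using Finset.card_le_two
        · simp only [Finset.mem_insert, Finset.mem_singleton, not_or] at ha
          exact ⟨fun e => ha.1 e.symm, hβ a ha.2⟩
      · exact ⟨∅, by simp [huT],
          fun a _ => ⟨fun h' => absurd h' huR, fun s hs => absurd hs (hno s)⟩⟩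
    · by_cases huT : u ∈ T
      · refine ⟨∅, by simp [huT], fun a _ => ⟨fun _ h' => absurd h' hdeg, ?_⟩⟩
        intro s hs hsY
        obtain ⟨-, -, y, huy, hyv, hy⟩ := huT
        have hys : y = s := ((hs.2 y).1 huy).resolve_left hyv
        subst hys
        obtain ⟨w, hw⟩ := HasNbrPair.exists_of_degree_eq_two hy huy.symm
        exact absurd ⟨u, w, hs, hw⟩ hsY
      · by_cases hex : ∃ s, HasNbrPair G u v s
        · obtain ⟨s, hs⟩ := hex
          refine ⟨{f s}, by simp [huT], fun a ha => ⟨fun _ h' => absurd h' hdeg, ?_⟩⟩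
          intro s' hs' _
          have hss : s' = s := ((hs.2 s').1 hs'.right).resolve_left hs'.1.symm
          subst hss
          exact fun e => ha (by simp [e])
        · exact ⟨∅, by simp [huT],
            fun a _ => ⟨fun _ h' => absurd h' hdeg, fun s hs => absurd ⟨s, hs⟩ hex⟩⟩
  choose! F hFcard hF using hforb
  have hTcard : T.ncard = ∑ u ∈ G.neighborFinset v, if u ∈ T then 1 else 0 := by
    rw [← Finset.card_filter, ← Set.ncard_coe_finset]
    congr 1
    ext u
    simp only [Finset.coe_filter, SimpleGraph.mem_neighborFinset, Set.mem_ofPred_eq]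
    exact ⟨fun hu => ⟨hu.1, hu⟩, fun hu => hu.2⟩
  have hBcard : {u | G.Adj v u ∧ 3 ≤ G.degree u}.ncard =
      ∑ u ∈ G.neighborFinset v, if 3 ≤ G.degree u then 1 else 0 := by
    rw [← Finset.card_filter, ← Set.ncard_coe_finset]
    congr 1
    ext u
    simp
  have hsum := Finset.sum_le_sum hFcard
  rw [Finset.sum_add_distrib, Finset.sum_add_distrib, ← hTcard, ← hBcard, Finset.sum_const,
    SimpleGraph.card_neighborFinset_eq_degree, smul_eq_mul, mul_one] at hsum
  have hcard : (insert α ((G.neighborFinset v).biUnion F)).card <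
      (Finset.univ : Finset (Fin c)).card := by
    have h1 := Finset.card_insert_le α ((G.neighborFinset v).biUnion F)
    have h2 := Finset.card_biUnion_le (s := G.neighborFinset v) (t := F)
    rw [Finset.card_univ, Fintype.card_fin]
    omega
  obtain ⟨a, -, ha⟩ := Finset.exists_mem_notMem_of_card_lt_card hcard
  simp only [Finset.mem_insert, Finset.mem_biUnion, not_or, not_exists, not_and] at ha
  refine ⟨a, ha.1, fun u hu hvu hdeg => ?_, fun u s hN hs => ?_⟩
  · have hu' : u ∈ G.neighborFinset v := by simpa using hvu
    exact (hF u hu' a (ha.2 u hu')).1 hu hdeg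
  · have hu' : u ∈ G.neighborFinset v := by simpa using hN.left.symm
    exact (hF u hu' a (ha.2 u hu')).2 s hN hs

theorem PCFCritical.false_of_threads (hG : PCFCritical G c) (hc : 4 ≤ c)
    (hd : 3 ≤ G.degree v) (hd' : G.degree v ≤ 5) {x y z w : V} (hx : HasNbrPair G x v y)
    (hy : HasNbrPair G y x z) (hz : HasNbrPair G z y w)
    (hcount : G.degree v + {u | G.Adj v u ∧ 3 ≤ G.degree u}.ncard ≤
      {x | G.Adj v x ∧ G.degree x = 2 ∧ ∃ y, G.Adj x y ∧ y ≠ v ∧ G.degree y = 2}.ncard + 2) :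
    False := by
  classical
  obtain ⟨hvz, hzY, hwv, hwL, hwY⟩ := hG.end_of_threeThread hc hd hx hy hz
  have hzv : z ≠ v := (hG.end_of_twoThread hc hd hx hy).1
  have hwO : w ∈ outerVerts G v z := ⟨hwv, hwL, hwY, hz.right.ne'⟩
  have hyY : y ∈ secondVerts G v := ⟨x, z, hx, hy⟩
  have hxL : x ∈ lowNbrs G v := ⟨hx.left.symm, hx.degree_eq_two.le⟩
  have hYadj : ∀ t ∈ secondVerts G v, ¬ G.Adj v t := fun t ht =>
    hG.not_adj_of_mem_secondVerts hc hd ht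
  obtain ⟨R, f, hf, hOR, hvR, hxR, hyR, hzR, hwnbr, hq⟩ := hG.exists_outer_coloring hc hd hx hy hz
  obtain ⟨α, hα⟩ := hf.exists_conflictFreeAvoiding (hOR hwO) hwv
  obtain ⟨a, haα, hbig, hlow⟩ := hf.exists_center_color hc hvR α hcount
  have hwa : G.Adj v w → f w ≠ a := fun hvw =>
    (hbig w (hOR hwO) hvw (three_le_degree_of_notMem_lowNbrs hvw hwL)).1
  have hqa : ∀ q ∈ R, q ∉ outerVerts G v z → f q ≠ a := by
    intro q hqR hqO
    obtain ⟨-, hwq, honly, -⟩ := hq q hqR hqO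
    obtain ⟨s, hs, hws, hsa, -⟩ := hα a haα ⟨q, hqR, hwq⟩
    rwa [← honly s hs hws]
  -- Color `v` with `a`.
  have hf₁ : IsPartialPCF G v (insert v R) (Function.update f v a) := by
    refine hf.insert_update hvR ?_ ?_ (fun h => absurd rfl h)
    · intro u hu hvu
      by_cases huO : u ∈ outerVerts G v z
      · exact (hbig u hu hvu (three_le_degree_of_notMem_lowNbrs hvu huO.2.1)).1
      · exact hqa u hu huO
    · intro u hu hvu _
      by_cases huO : u ∈ outerVerts G v z
      · exact (hbig u hu hvu (three_le_degree_of_notMem_lowNbrs hvu huO.2.1)).2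
      · obtain ⟨hvw, -, -, m, hmR, hN⟩ := hq u hu huO
        exact fun _ => ⟨w, hOR hwO, hN.right, hwa hvw, fun t ht hut _ =>
          ((hN.2 t).1 hut).resolve_left (fun e => hmR (e ▸ ht))⟩
  -- Color `z` with `a`, unless `w` has that color.
  obtain ⟨D, g, hg, hRD, hvD, hDR, hgR, hgv, hDz⟩ : ∃ (D : Set V) (g : V → Fin c),
      IsPartialPCF G v D g ∧ R ⊆ D ∧ v ∈ D ∧ (∀ t ∈ D, t ∈ R ∨ t = v ∨ t = z) ∧
      (∀ t ∈ R, g t = f t) ∧ g v = a ∧ ((z ∈ D ∧ g z = a) ∨ (z ∉ D ∧ f w = a)) := by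
    have hval : ∀ t ∈ R, Function.update f v a t = f t := fun t ht =>
      Function.update_of_ne (fun e : t = v => hvR (e ▸ ht)) _ _
    by_cases hfw : f w = a
    · exact ⟨_, _, hf₁, Set.subset_insert _ _, Or.inl rfl, by grind, hval, by simp,
        Or.inr ⟨fun h => h.elim hzv hzR, hfw⟩⟩
    have honly : ∀ t ∈ insert v R, G.Adj z t → t = w := fun t ht hzt =>
      ((hz.2 t).1 hzt).resolve_left (by
        rintro rfl
        exact ht.elim (fun e => hx.1 e.symm) hyR)
    refine ⟨insert z (insert v R), Function.update (Function.update f v a) z a,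
      hf₁.insert_update (fun h => h.elim hzv hzR) ?_ ?_ ?_,
      fun t ht => Or.inr (Or.inr ht), Or.inr (Or.inl rfl), by grind, ?_, ?_,
      Or.inl ⟨Or.inl rfl, by simp⟩⟩
    · intro t ht hzt
      rw [honly t ht hzt, hval w (hOR hwO)]; exact hfw
    · intro t ht hzt _
      rw [honly t ht hzt]
      rintro ⟨s, hs, hws⟩
      have hex : ∃ s ∈ R, G.Adj w s := by
        rcases hs with rfl | hs
        exacts [hwnbr hws.symm, ⟨s, hs, hws⟩]
      obtain ⟨r, hr, hwr, hra, huniq⟩ := hα a haα hex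
      refine ⟨r, Or.inr hr, hwr, by rwa [hval r hr], ?_⟩
      rintro t (rfl | ht) hwt htr
      · rw [Function.update_self, hval r hr] at htr
        exact absurd htr.symm hra
      · rw [hval t ht, hval r hr] at htr
        exact huniq t ht hwt htr
    · rintro - -
      exact ⟨w, Or.inr (hOR hwO), hz.right, fun t ht hzt _ => honly t ht hzt⟩
    · intro t ht
      rw [Function.update_of_ne (fun e : t = z => hzR (e ▸ ht)), hval t ht]
    · rw [Function.update_of_ne hzv.symm, Function.update_self]
  -- Color the second vertices of the other 2-threads.
  obtain ⟨g', hg', hgg', hsec⟩ := hg.exists_extension_second hc (secondVerts G v \ {y}) (by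
    rintro t ⟨ht, hty⟩ -
    obtain ⟨x', w', hx', htN⟩ := ht
    obtain ⟨hw'v, hw'L, hw'Y⟩ := hG.end_of_twoThread hc hd hx' htN
    have htY : t ∈ secondVerts G v := ⟨x', w', hx', htN⟩
    have hw'z : w' ≠ z := by
      rintro rfl
      rcases (hz.2 t).1 htN.right.symm with e | e
      exacts [hty e, hwY (e ▸ htY)]
    refine ⟨x', w', htN, hRD (hOR ⟨hw'v, hw'L, hw'Y, hw'z⟩), hw'v, ?_,
      fun h => hYadj x' h.1 hx'.left.symm⟩
    intro hx'D
    have hx'R : x' ∈ R := by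
      rcases hDR x' hx'D with h | h | h
      exacts [h, absurd h hx'.left.ne, absurd hx'.left.symm (h ▸ hvz)]
    obtain ⟨-, hwx', -⟩ := hq x' hx'R (fun h => h.2.1 ⟨hx'.left.symm, hx'.degree_eq_two.le⟩)
    exact ((hx'.2 w).1 hwx'.symm).elim hwv (fun e => hwY (e ▸ htY)))
  -- Color the other neighbors of `v` of degree at most two.
  obtain ⟨k, hk, hkg'⟩ := hg'.exists_extension_first hc (lowNbrs G v \ {x}) (Or.inl hvD) (by
    rintro u ⟨⟨hvu, hu⟩, hux⟩ -
    by_cases hleaf : ∀ t, G.Adj u t → t = v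
    · exact Or.inl hleaf
    push Not at hleaf
    obtain ⟨s, hus, hsv⟩ := hleaf
    have hN : HasNbrPair G u v s := .of_degree_le_two hu hvu.symm hus hsv.symm
    rw [hgg' v hvD, hgv]
    refine Or.inr ⟨s, ?_⟩
    by_cases hsY : s ∈ secondVerts G v
    · have hsy : s ≠ y := by
        rintro rfl
        rcases (hy.2 u).1 hus.symm with e | e
        exacts [hux e, hvz (e ▸ hvu)]
      refine ⟨Or.inr ⟨hsY, hsy⟩, hN, ?_⟩
      by_cases hsD : s ∈ D
      · have hsR : s ∈ R := by
          rcases hDR s hsD with h | h | h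
          exacts [h, absurd h hsv, absurd hsY (h ▸ hzY)]
        rw [hgg' s hsD, hgR s hsR]
        exact hqa s hsR (fun h => h.2.2.1 hsY)
      · rw [← hgv]
        exact hsec s ⟨hsY, hsy⟩ hsD
    · have hsL : s ∉ lowNbrs G v := fun hsL => hG.false_of_cycle_three hc hd hN
        (.of_degree_le_two hsL.2 hus.symm hsL.1.symm hvu.ne')
      have hsz : s ≠ z := by
        rintro rfl
        rcases (hz.2 u).1 hus.symm with e | e
        exacts [hYadj y hyY (e ▸ hvu), hwL (e ▸ ⟨hvu, hu⟩)]
      have hsR : s ∈ R := hOR ⟨hsv, hsL, hsY, hsz⟩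
      refine ⟨Or.inl (hRD hsR), hN, ?_⟩
      rw [hgg' s (hRD hsR), hgR s hsR]
      exact hlow u s hN hsY)
  have hkD : ∀ t ∈ D, k t = g t := fun t ht => by rw [hkg' t (Or.inl ht), hgg' t ht]
  have hmem : ∀ t, t ∈ D ∪ (secondVerts G v \ {y}) ∪ (lowNbrs G v \ {x}) ↔
      t ≠ x ∧ t ≠ y ∧ (t = z → z ∈ D) := by
    intro t
    have hxY : x ∉ secondVerts G v := fun h => hYadj x h hx.left.symm
    have hyL : y ∉ lowNbrs G v := fun h => hYadj y hyY h.1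
    have hzL : z ∉ lowNbrs G v := fun h => hvz h.1
    have hxz : x ≠ z := hy.1
    have hyz : y ≠ z := hy.right.ne
    have hxv : x ≠ v := hx.left.ne
    have hyv : y ≠ v := hx.1.symm
    have hO : t ∈ outerVerts G v z ↔
      t ≠ v ∧ t ∉ lowNbrs G v ∧ t ∉ secondVerts G v ∧ t ≠ z := Iff.rfl
    have hOD : t ∈ outerVerts G v z → t ∈ D := fun h => hRD (hOR h)
    have hDt := hDR t
    simp only [Set.mem_union, Set.mem_sdiff, Set.mem_singleton_iff]
    grind
  refine hG.1 (hk.exists_pcf_of_threeThread hc hd' hx hy hz hzv hvz hwv ?_)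
  rw [hkD v hvD, hgv]
  rcases hDz with ⟨hzD, hgz⟩ | ⟨hzD, hfw⟩
  · refine Or.inl ⟨?_, by rw [hkD z hzD, hgz]⟩
    ext t
    rw [hmem t]
    simp [hzD]
  · refine Or.inr ⟨?_, by rw [hkD w (hRD (hOR hwO)), hgR w (hOR hwO), hfw]⟩
    ext t
    rw [hmem t]
    simp [hzD]

end Core

/-- For `c ≥ 4` and `d ∈ {4,5}`, if a `d`-vertex `v` of a `c`-PCF-critical graph
is adjacent to a `3`-thread, then `v` is adjacent to at most `3d + n_{3⁺}(v) - 11`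
`2`-threads. -/
theorem thread_bound {c : ℕ} (hc : 4 ≤ c) {V : Type*} [Fintype V]
    (G : SimpleGraph V) [DecidableRel G.Adj] (hG : PCFCritical G c)
    {d : ℕ} (hd : d = 4 ∨ d = 5) (v : V) (hv : G.degree v = d)
    (hthread : ∃ x y z : V, x ≠ z ∧ v ≠ x ∧ v ≠ y ∧ v ≠ z ∧
      G.Adj v x ∧ G.Adj x y ∧ G.Adj y z ∧
      G.degree x = 2 ∧ G.degree y = 2 ∧ G.degree z = 2) :
    (({x : V | G.Adj v x ∧ G.degree x = 2 ∧
        ∃ y, G.Adj x y ∧ y ≠ v ∧ G.degree y = 2}.ncard : ℤ))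
      ≤ 3 * d + nDegGE G v 3 - 11 := by
  obtain ⟨x, y, z, hxz, -, hvy, -, hvx, hxy, hyz, hx, hy, hz⟩ := hthread
  have hxN : HasNbrPair G x v y := .of_degree_le_two hx.le hvx.symm hxy hvy
  have hyN : HasNbrPair G y x z := .of_degree_le_two hy.le hxy.symm hyz hxz
  obtain ⟨w, hzN⟩ := HasNbrPair.exists_of_degree_eq_two hz hyz.symm
  by_contra hlt
  unfold nDegGE at hlt
  exact hG.false_of_threads hc (by omega) (by omega) hxN hyN hzN (by omega)
end

section
/- For every integer c ≥ 5, if v₁ and v₂ are adjacent vertices of degree at least 3 in a c-PCF-critical graph G such that 2·deg(v_i) − n₂(v_i) − 2 ≤ c − i for each i ∈ {1, 2}, then v₁ has degree at least 4, and at least one of v₁, v₂ has no neighbor of degree 2. -/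
open SimpleGraph

/-- Some color appears on exactly one neighbor of `v` inside `S`. -/
def HasUniqueColorOn {V : Type*} {c : ℕ} (G : SimpleGraph V) (f : V → Fin c)
    (S : Finset V) (v : V) : Prop :=
  ∃ u ∈ S, G.Adj v u ∧ ∀ w ∈ S, G.Adj v w → f w = f u → w = u

/-- The colors appearing on the neighbors of `v` inside `S`. -/
noncomputable def colorsAround {V : Type*} {c : ℕ} (G : SimpleGraph V) (f : V → Fin c)
    (S : Finset V) (v : V) : Finset (Fin c) :=
  open Classical in (S.filter (G.Adj v)).image f

/-- A coloring of `S` in which every vertex outside `S` has exactly two neighbors, both in `S` and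
with distinct colors, and every vertex of `S` without a uniquely occurring neighbor color still has
a neighbor outside `S` and sees few colors. -/
structure IsAlmostPCFOn {V : Type*} {c : ℕ} (G : SimpleGraph V) (f : V → Fin c)
    (S : Finset V) : Prop where
  proper : ∀ u ∈ S, ∀ v ∈ S, G.Adj u v → f u ≠ f v
  unique_or : ∀ v ∈ S, (∃ u, G.Adj v u) → HasUniqueColorOn G f S v ∨
    (∃ x, x ∉ S ∧ G.Adj v x) ∧ 4 * (colorsAround G f S v).card ≤ c
  outside : ∀ x, x ∉ S → ∃ p ∈ S, ∃ q ∈ S, G.Adj x p ∧ G.Adj x q ∧ f p ≠ f q ∧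
    ∀ z, G.Adj x z → z = p ∨ z = q

section Extension

variable {V : Type*} {c : ℕ} {G : SimpleGraph V} {f : V → Fin c} {S : Finset V}

theorem mem_colorsAround {v : V} {a : Fin c} :
    a ∈ colorsAround G f S v ↔ ∃ w ∈ S, G.Adj v w ∧ f w = a := by
  simp [colorsAround, and_assoc]

theorem colorsAround_eq_empty {v : V} (h : ¬ ∃ u ∈ S, G.Adj v u) :
    colorsAround G f S v = ∅ := by
  ext a
  simp only [mem_colorsAround, Finset.notMem_empty, iff_false]
  rintro ⟨w, hw, hvw, -⟩
  exact h ⟨w, hw, hvw⟩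

theorem exists_notMem_of_card_lt {F : Finset (Fin c)} (h : F.card < c) : ∃ a, a ∉ F := by
  by_contra! hF
  have : F = Finset.univ := Finset.eq_univ_iff_forall.2 hF
  simp [this] at h

theorem two_mul_card_image_le {α β : Type*} [DecidableEq β] (N : Finset α) (g : α → β)
    (h : ∀ u ∈ N, ∃ w ∈ N, g w = g u ∧ w ≠ u) : 2 * (N.image g).card ≤ N.card := by
  classical
  refine Finset.mul_card_image_le_card N 2 fun b hb => ?_
  obtain ⟨u, hu, rfl⟩ := Finset.mem_image.1 hb
  obtain ⟨w, hw, hwu, hne⟩ := h u hu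
  exact Finset.one_lt_card.2 ⟨w, by simp [hw, hwu], u, by simp [hu], hne⟩

theorem HasUniqueColorOn.update_insert_of_not_adj [DecidableEq V] {v x : V}
    (h : HasUniqueColorOn G f S v) (hx : x ∉ S) (hvx : ¬ G.Adj v x) (a : Fin c) :
    HasUniqueColorOn G (Function.update f x a) (insert x S) v := by
  obtain ⟨u, hu, hvu, huniq⟩ := h
  refine ⟨u, Finset.mem_insert_of_mem hu, hvu, fun w hw hvw hfw => ?_⟩
  have hwx : w ≠ x := by rintro rfl; exact hvx hvw
  have hux : u ≠ x := by rintro rfl; exact hx hu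
  rw [Function.update_of_ne hwx, Function.update_of_ne hux] at hfw
  exact huniq w (Finset.mem_of_mem_insert_of_ne hw hwx) hvw hfw

theorem colorsAround_update_insert_of_not_adj [DecidableEq V] {v x : V}
    (hvx : ¬ G.Adj v x) (a : Fin c) :
    colorsAround G (Function.update f x a) (insert x S) v = colorsAround G f S v := by
  ext b
  simp only [mem_colorsAround]
  constructor
  · rintro ⟨w, hw, hvw, hb⟩
    have hwx : w ≠ x := by rintro rfl; exact hvx hvw
    rw [Function.update_of_ne hwx] at hb
    exact ⟨w, Finset.mem_of_mem_insert_of_ne hw hwx, hvw, hb⟩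
  · rintro ⟨w, hw, hvw, hb⟩
    have hwx : w ≠ x := by rintro rfl; exact hvx hvw
    exact ⟨w, Finset.mem_insert_of_mem hw, hvw, by rwa [Function.update_of_ne hwx]⟩

/-- Few colors have to be avoided at a new neighbor `x` of `v` in order to give `v` a uniquely
occurring neighbor color. -/
theorem exists_avoid_hasUniqueColorOn [DecidableEq V] {v x : V} (hx : x ∉ S) (hvx : G.Adj v x)
    (h : HasUniqueColorOn G f S v ∨ 4 * (colorsAround G f S v).card ≤ c) :
    ∃ K : Finset (Fin c), (K.card ≤ 1 ∨ 4 * K.card ≤ c) ∧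
      ∀ a ∉ K, HasUniqueColorOn G (Function.update f x a) (insert x S) v := by
  rcases h with ⟨u, hu, hvu, huniq⟩ | h
  · refine ⟨{f u}, by simp, fun a ha => ⟨u, Finset.mem_insert_of_mem hu, hvu, ?_⟩⟩
    intro w hw hvw hfw
    have hux : u ≠ x := by rintro rfl; exact hx hu
    rw [Function.update_of_ne hux] at hfw
    by_cases hwx : w = x
    · subst hwx
      simp only [Function.update_self] at hfw
      simp [hfw] at ha
    · rw [Function.update_of_ne hwx] at hfw
      exact huniq w (Finset.mem_of_mem_insert_of_ne hw hwx) hvw hfw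
  · refine ⟨_, Or.inr h, fun a ha => ⟨x, Finset.mem_insert_self _ _, hvx, ?_⟩⟩
    intro w hw hvw hfw
    by_contra hwx
    rw [Function.update_of_ne hwx, Function.update_self] at hfw
    exact ha (mem_colorsAround.2 ⟨w, Finset.mem_of_mem_insert_of_ne hw hwx, hvw, hfw⟩)

theorem IsAlmostPCFOn.exists_insert [DecidableEq V] (hc : 5 ≤ c) (h : IsAlmostPCFOn G f S)
    {x : V} (hx : x ∉ S) :
    ∃ a, IsAlmostPCFOn G (Function.update f x a) (insert x S) := by
  obtain ⟨p, hp, q, hq, hxp, hxq, hpq, hN⟩ := h.outside x hx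
  obtain ⟨K, hK, hKp⟩ := exists_avoid_hasUniqueColorOn hx hxp.symm
    ((h.unique_or p hp ⟨x, hxp.symm⟩).imp_right And.right)
  obtain ⟨L, hL, hLq⟩ := exists_avoid_hasUniqueColorOn hx hxq.symm
    ((h.unique_or q hq ⟨x, hxq.symm⟩).imp_right And.right)
  obtain ⟨a, ha⟩ : ∃ a, a ∉ ({f p, f q} : Finset (Fin c)) ∪ (K ∪ L) := by
    apply exists_notMem_of_card_lt
    have h1 := Finset.card_union_le ({f p, f q} : Finset (Fin c)) (K ∪ L)
    have h2 := Finset.card_union_le K L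
    have h3 : ({f p, f q} : Finset (Fin c)).card ≤ 2 := Finset.card_le_two
    omega
  simp only [Finset.mem_union, Finset.mem_insert, Finset.mem_singleton, not_or] at ha
  obtain ⟨⟨hap, haq⟩, haK, haL⟩ := ha
  have hne : ∀ z ∈ S, z ≠ x := by rintro z hz rfl; exact hx hz
  have hax : ∀ z, G.Adj x z → a ≠ f z := by
    intro z hz
    rcases hN z hz with rfl | rfl
    · exact hap
    · exact haq
  refine ⟨a, ⟨?_, ?_, ?_⟩⟩
  · intro u hu v hv huv
    rw [Finset.mem_insert] at hu hv
    rcases hu with rfl | hu <;> rcases hv with rfl | hv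
    · exact absurd huv (G.loopless.irrefl _)
    · rw [Function.update_self, Function.update_of_ne (hne v hv)]
      exact hax v huv
    · rw [Function.update_self, Function.update_of_ne (hne u hu)]
      exact (hax u huv.symm).symm
    · rw [Function.update_of_ne (hne u hu), Function.update_of_ne (hne v hv)]
      exact h.proper u hu v hv huv
  · intro v hv hvn
    rcases Finset.mem_insert.1 hv with rfl | hv
    · refine Or.inl ⟨p, Finset.mem_insert_of_mem hp, hxp, fun w _ hvw hfw => ?_⟩
      rcases hN w hvw with rfl | rfl
      · rfl
      · rw [Function.update_of_ne (hne w hq), Function.update_of_ne (hne p hp)] at hfw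
        exact absurd hfw.symm hpq
    · by_cases hvx : G.Adj v x
      · left
        rcases hN v hvx.symm with rfl | rfl
        · exact hKp a haK
        · exact hLq a haL
      · rcases h.unique_or v hv hvn with hu | ⟨⟨y, hy, hvy⟩, hcard⟩
        · exact Or.inl (hu.update_insert_of_not_adj hx hvx a)
        · refine Or.inr ⟨⟨y, ?_, hvy⟩, ?_⟩
          · rw [Finset.mem_insert, not_or]
            exact ⟨by rintro rfl; exact hvx hvy, hy⟩
          · rwa [colorsAround_update_insert_of_not_adj hvx]
  · intro y hy
    rw [Finset.mem_insert, not_or] at hy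
    obtain ⟨r, hr, s, hs, hyr, hys, hrs, hM⟩ := h.outside y hy.2
    refine ⟨r, Finset.mem_insert_of_mem hr, s, Finset.mem_insert_of_mem hs, hyr, hys, ?_, hM⟩
    rwa [Function.update_of_ne (hne r hr), Function.update_of_ne (hne s hs)]

theorem IsAlmostPCFOn.exists_isPCFColoring [Fintype V] (hc : 5 ≤ c)
    (h : IsAlmostPCFOn G f S) : ∃ g : V → Fin c, IsPCFColoring G g := by
  classical
  induction hn : Sᶜ.card generalizing S f with
  | zero =>
    have hS : S = Finset.univ := by simpa using hn
    subst hS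
    refine ⟨f, fun u v huv => h.proper u (Finset.mem_univ u) v (Finset.mem_univ v) huv,
      fun v hv => ?_⟩
    rcases h.unique_or v (Finset.mem_univ v) hv with ⟨u, -, hvu, hu⟩ | ⟨⟨x, hx, -⟩, -⟩
    · exact ⟨u, hvu, fun w => hu w (Finset.mem_univ w)⟩
    · exact absurd (Finset.mem_univ x) hx
  | succ n ih =>
    obtain ⟨x, hx⟩ : Sᶜ.Nonempty := Finset.card_pos.1 (by omega)
    obtain ⟨a, ha⟩ := h.exists_insert hc (Finset.mem_compl.1 hx)
    refine ih ha ?_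
    rw [Finset.compl_insert, Finset.card_erase_of_mem hx, hn, Nat.add_sub_cancel]

end Extension

section Critical

variable {V : Type*} {c : ℕ} {G : SimpleGraph V}

theorem PCFCritical.exists_coloring_on [NeZero c] (hG : PCFCritical G c) (S : Finset V) {x : V}
    (hx : x ∉ S) :
    ∃ f : V → Fin c, (∀ u ∈ S, ∀ v ∈ S, G.Adj u v → f u ≠ f v) ∧
      ∀ v ∈ S, (∃ u ∈ S, G.Adj v u) → HasUniqueColorOn G f S v := by
  classical
  obtain ⟨g, hproper, huniq⟩ := hG.2 ((⊤ : G.Subgraph).induce S) (fun h => hx (by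
    have : x ∈ ((⊤ : G.Subgraph).induce (S : Set V)).verts := by rw [h]; trivial
    simpa using this))
  have hverts : ∀ v, v ∈ ((⊤ : G.Subgraph).induce (S : Set V)).verts ↔ v ∈ S := by simp
  refine ⟨fun v => if h : v ∈ S then g ⟨v, (hverts v).2 h⟩ else 0, ?_, ?_⟩
  · intro u hu v hv huv
    simp only [hu, hv, dif_pos]
    exact hproper (by simpa [hu, hv] using huv)
  · rintro v hv ⟨u, hu, hvu⟩
    obtain ⟨⟨w, hw⟩, hvw, hwuniq⟩ := huniq ⟨v, (hverts v).2 hv⟩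
      ⟨⟨u, (hverts u).2 hu⟩, by simpa [hu, hv] using hvu⟩
    have hwS := (hverts w).1 hw
    refine ⟨w, hwS, by simpa [hv, hwS] using hvw, fun z hz hvz hfz => ?_⟩
    simp only [hz, hwS, dif_pos] at hfz
    simpa using hwuniq ⟨z, (hverts z).2 hz⟩ (by simpa [hz, hv] using hvz) hfz

theorem exists_other_neighbor [Fintype V] [DecidableRel G.Adj] {x y : V} (hx : G.degree x = 2)
    (hxy : G.Adj x y) :
    ∃ z, G.Adj x z ∧ z ≠ y ∧ ∀ w, G.Adj x w → w = y ∨ w = z := by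
  classical
  rw [← SimpleGraph.card_neighborFinset_eq_degree, Finset.card_eq_two] at hx
  obtain ⟨p, q, hpq, hN⟩ := hx
  have hmem : ∀ w, G.Adj x w ↔ w = p ∨ w = q := fun w => by
    rw [← SimpleGraph.mem_neighborFinset, hN]; simp
  rcases (hmem y).1 hxy with rfl | rfl
  · exact ⟨q, (hmem q).2 (Or.inr rfl), hpq.symm, fun w => (hmem w).1⟩
  · exact ⟨p, (hmem p).2 (Or.inl rfl), hpq, fun w hw => ((hmem w).1 hw).symm⟩

/-- In a critical graph, no two vertices of degree two are adjacent. -/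
theorem PCFCritical.degree_ne_two_of_adj [Fintype V] [DecidableRel G.Adj] (hc : 5 ≤ c)
    (hG : PCFCritical G c) {x y : V} (hxy : G.Adj x y) (hx : G.degree x = 2) :
    G.degree y ≠ 2 := by
  classical
  intro hy
  have : NeZero c := ⟨by omega⟩
  obtain ⟨p, hxp, hpy, hNx⟩ := exists_other_neighbor hx hxy
  obtain ⟨q, hyq, hqx, hNy⟩ := exists_other_neighbor hy hxy.symm
  set S : Finset V := {x, y}ᶜ with hS
  have hmem : ∀ z, z ∈ S ↔ z ≠ x ∧ z ≠ y := by simp [hS]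
  have hxS : x ∉ S := by simp [hmem]
  have hpS : p ∈ S := (hmem p).2 ⟨hxp.ne', hpy⟩
  have hqS : q ∈ S := (hmem q).2 ⟨hqx, hyq.ne'⟩
  obtain ⟨f, hproper, huniq⟩ := hG.exists_coloring_on S hxS
  have hdich : ∀ z ∈ S, HasUniqueColorOn G f S z ∨ colorsAround G f S z = ∅ := fun z hz => by
    by_cases h : ∃ u ∈ S, G.Adj z u
    · exact Or.inl (huniq z hz h)
    · exact Or.inr (colorsAround_eq_empty h)
  obtain ⟨K, hK, hKp⟩ := exists_avoid_hasUniqueColorOn (f := f) hxS hxp.symm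
    ((hdich p hpS).imp_right fun h => by simp [h])
  obtain ⟨a, ha⟩ : ∃ a, a ∉ ({f p, f q} : Finset (Fin c)) ∪ K := by
    apply exists_notMem_of_card_lt
    have h1 := Finset.card_union_le ({f p, f q} : Finset (Fin c)) K
    have h3 : ({f p, f q} : Finset (Fin c)).card ≤ 2 := Finset.card_le_two
    omega
  simp only [Finset.mem_union, Finset.mem_insert, Finset.mem_singleton, not_or] at ha
  obtain ⟨⟨hap, haq⟩, haK⟩ := ha
  have hne : ∀ z ∈ S, z ≠ x := fun z hz => ((hmem z).1 hz).1
  have hNS : ∀ z ∈ S, G.Adj x z → z = p := fun z hz hxz =>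
    (hNx z hxz).resolve_left ((hmem z).1 hz).2
  refine hG.1 (IsAlmostPCFOn.exists_isPCFColoring (f := Function.update f x a)
    (S := insert x S) hc ⟨?_, ?_, ?_⟩)
  · intro u hu v hv huv
    rw [Finset.mem_insert] at hu hv
    rcases hu with rfl | hu <;> rcases hv with rfl | hv
    · exact absurd huv (G.loopless.irrefl _)
    · rw [Function.update_self, Function.update_of_ne (hne v hv), hNS v hv huv]
      exact hap
    · rw [Function.update_self, Function.update_of_ne (hne u hu), hNS u hu huv.symm]
      exact Ne.symm hap
    · rw [Function.update_of_ne (hne u hu), Function.update_of_ne (hne v hv)]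
      exact hproper u hu v hv huv
  · rintro v hv ⟨u, hvu⟩
    rcases Finset.mem_insert.1 hv with rfl | hv
    · refine Or.inl ⟨p, Finset.mem_insert_of_mem hpS, hxp, fun w hw hvw _ => ?_⟩
      exact hNS w (Finset.mem_of_mem_insert_of_ne hw hvw.ne') hvw
    · by_cases hvx : G.Adj v x
      · left
        rw [hNS v hv hvx.symm]
        exact hKp a haK
      · by_cases hn : ∃ u ∈ S, G.Adj v u
        · exact Or.inl ((huniq v hv hn).update_insert_of_not_adj hxS hvx a)
        · refine Or.inr ⟨⟨u, ?_, hvu⟩, ?_⟩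
          · rw [Finset.mem_insert, not_or]
            exact ⟨by rintro rfl; exact hvx hvu, fun hu => hn ⟨u, hu, hvu⟩⟩
          · rw [colorsAround_update_insert_of_not_adj hvx, colorsAround_eq_empty hn]
            simp
  · intro z hz
    obtain rfl : z = y := by
      by_contra hzy
      rw [Finset.mem_insert, hmem] at hz
      tauto
    refine ⟨x, Finset.mem_insert_self _ _, q, Finset.mem_insert_of_mem hqS, hxy.symm, hyq, ?_,
      hNy⟩
    rw [Function.update_self, Function.update_of_ne hqx]
    exact haq

end Critical

section Counting

variable {V : Type*} {c : ℕ}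

/-- Adding one more vertex of color `a` to `N` leaves a color occurring exactly once. -/
def AdmitsColor (f : V → Fin c) (N : Finset V) (a : Fin c) : Prop :=
  (∃ u ∈ N, f u ≠ a ∧ ∀ w ∈ N, f w = f u → w = u) ∨ ∀ w ∈ N, f w ≠ a

theorem exists_avoid_admitsColor (f : V → Fin c) (N : Finset V) :
    ∃ B : Finset (Fin c), (B.card ≤ 1 ∨ 2 * B.card ≤ N.card) ∧ ∀ a ∉ B, AdmitsColor f N a := by
  by_cases h : ∃ u ∈ N, ∀ w ∈ N, f w = f u → w = u
  · obtain ⟨u, hu, huniq⟩ := h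
    refine ⟨{f u}, by simp, fun a ha => Or.inl ⟨u, hu, ?_, huniq⟩⟩
    rintro rfl
    simp at ha
  · push Not at h
    refine ⟨N.image f, Or.inr (two_mul_card_image_le N f h), fun a ha => Or.inr ?_⟩
    rintro w hw rfl
    exact ha (Finset.mem_image_of_mem f hw)

theorem admitsColor_of_card_eq_two {f : V → Fin c} {N : Finset V} (hN : N.card = 2)
    (hf : ¬ ∃ b, ∀ w ∈ N, f w = b) (a : Fin c) : AdmitsColor f N a := by
  classical
  obtain ⟨p, q, -, rfl⟩ := Finset.card_eq_two.1 hN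
  have hne : f p ≠ f q := fun h => hf ⟨f p, by simp [h]⟩
  by_cases ha : f p = a
  · exact Or.inl ⟨q, by simp, fun h => hne (ha.trans h.symm), by simp [hne]⟩
  · exact Or.inl ⟨p, by simp, ha, by simp [hne.symm]⟩

/-- The colors forbidden at `v` by its colored neighbors `N` and its uncolored neighbors `T`
of degree two. -/
theorem exists_forbidden_colors [Fintype V] (G : SimpleGraph V) [DecidableRel G.Adj]
    (f φ : V → Fin c) (v : V) (N T : Finset V) (hT : ∀ x ∈ T, G.Adj v x ∧ G.degree x = 2) :
    ∃ F : Finset (Fin c), F.card ≤ 2 * N.card + T.card ∧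
      ((∃ b, ∀ w ∈ N, f w = b) → F.card ≤ 1 + N.card + T.card) ∧
      (∀ w ∈ N, f w ∈ F ∧ φ w ∈ F) ∧
      ∀ x ∈ T, ∀ y, G.Adj x y → y ≠ v → f y ∈ F := by
  classical
  set E := T.biUnion fun x => ((G.neighborFinset x).erase v).image f with hE
  have hEcard : E.card ≤ T.card := by
    refine (Finset.card_biUnion_le_card_mul _ _ 1 fun x hx => ?_).trans (by simp)
    refine Finset.card_image_le.trans ?_
    rw [Finset.card_erase_of_mem (by simpa using (hT x hx).1.symm),
      SimpleGraph.card_neighborFinset_eq_degree, (hT x hx).2]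
  have h1 := Finset.card_union_le (N.image f) (N.image φ ∪ E)
  have h2 := Finset.card_union_le (N.image φ) E
  have h3 : (N.image φ).card ≤ N.card := Finset.card_image_le
  have h4 : (N.image f).card ≤ N.card := Finset.card_image_le
  refine ⟨N.image f ∪ (N.image φ ∪ E), by omega, ?_, ?_, ?_⟩
  · rintro ⟨b, hb⟩
    have : (N.image f).card ≤ ({b} : Finset (Fin c)).card :=
      Finset.card_le_card fun z hz => by
        obtain ⟨w, hw, rfl⟩ := Finset.mem_image.1 hz
        simp [hb w hw]
    rw [Finset.card_singleton] at this
    omega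
  · intro w hw
    exact ⟨Finset.mem_union_left _ (Finset.mem_image_of_mem f hw),
      Finset.mem_union_right _ (Finset.mem_union_left _ (Finset.mem_image_of_mem φ hw))⟩
  · intro x hx y hxy hy
    refine Finset.mem_union_right _ (Finset.mem_union_right _ (Finset.mem_biUnion.2 ⟨x, hx, ?_⟩))
    exact Finset.mem_image_of_mem f (by simp [hxy, hy])

theorem exists_color_pair (hc : 5 ≤ c) (f : V → Fin c) {N₁ N₂ T₁ T₂ : Finset V}
    {F₁ F₂ : Finset (Fin c)}
    (hF₁ : F₁.card ≤ 2 * N₁.card + T₁.card) (hF₂ : F₂.card ≤ 2 * N₂.card + T₂.card)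
    (hF₁' : (∃ b, ∀ w ∈ N₁, f w = b) → F₁.card ≤ 1 + N₁.card + T₁.card)
    (h₁ : 2 * N₁.card + T₁.card + 1 ≤ c) (h₂ : 2 * N₂.card + T₂.card + 2 ≤ c)
    (hdeg : 2 ≤ N₂.card + T₂.card)
    (h : N₁.card + T₁.card = 2 ∨ T₁.card ≠ 0 ∧ T₂.card ≠ 0) :
    ∃ a₁ a₂, a₁ ≠ a₂ ∧ a₁ ∉ F₁ ∧ a₂ ∉ F₂ ∧ (T₁ = ∅ → AdmitsColor f N₁ a₂) ∧
      (T₂ = ∅ → AdmitsColor f N₂ a₁) := by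
  obtain ⟨B, hB, hBN⟩ : ∃ B : Finset (Fin c),
      (B.card = 0 ∨ T₂.card = 0 ∧ (B.card ≤ 1 ∨ 2 * B.card ≤ N₂.card)) ∧
      ∀ a ∉ B, T₂ = ∅ → AdmitsColor f N₂ a := by
    by_cases hT : T₂ = ∅
    · obtain ⟨B, hB, hBN⟩ := exists_avoid_admitsColor f N₂
      exact ⟨B, Or.inr ⟨by simp [hT], hB⟩, fun a ha _ => hBN a ha⟩
    · exact ⟨∅, by simp, fun a _ h => absurd h hT⟩
  have hFB := Finset.card_union_le F₁ B
  by_cases hconst : T₁ = ∅ ∧ ∃ b, ∀ w ∈ N₁, f w = b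
  · obtain ⟨hT₁, b, hb⟩ := hconst
    have hF₁b := hF₁' ⟨b, hb⟩
    have hT₁' : T₁.card = 0 := by simp [hT₁]
    obtain ⟨a₂, ha₂⟩ : ∃ a, a ∉ insert b F₂ := by
      apply exists_notMem_of_card_lt
      have := Finset.card_insert_le b F₂
      omega
    obtain ⟨a₁, ha₁⟩ : ∃ a, a ∉ insert a₂ (F₁ ∪ B) := by
      apply exists_notMem_of_card_lt
      have := Finset.card_insert_le a₂ (F₁ ∪ B)
      omega
    simp only [Finset.mem_insert, Finset.mem_union, not_or] at ha₁ ha₂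
    exact ⟨a₁, a₂, ha₁.1, ha₁.2.1, ha₂.2,
      fun _ => Or.inr fun w hw => by rw [hb w hw]; exact Ne.symm ha₂.1, hBN a₁ ha₁.2.2⟩
  · obtain ⟨a₁, ha₁⟩ : ∃ a, a ∉ F₁ ∪ B := by
      apply exists_notMem_of_card_lt
      omega
    obtain ⟨a₂, ha₂⟩ : ∃ a, a ∉ insert a₁ F₂ := by
      apply exists_notMem_of_card_lt
      have := Finset.card_insert_le a₁ F₂
      omega
    simp only [Finset.mem_insert, Finset.mem_union, not_or] at ha₁ ha₂
    refine ⟨a₁, a₂, Ne.symm ha₂.1, ha₁.1, ha₂.2, fun hT₁ => ?_, hBN a₁ ha₁.2⟩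
    have hT₁' : T₁.card = 0 := by simp [hT₁]
    exact admitsColor_of_card_eq_two (by omega) (fun hb => hconst ⟨hT₁, hb⟩) a₂

/-- A vertex `v` whose neighbors in `S` are `v'` and the vertices of `N` has a uniquely occurring
neighbor color, or it has a neighbor outside `S` and sees few colors. -/
theorem hasUniqueColorOn_or_of_admitsColor {G : SimpleGraph V} {f g : V → Fin c}
    {S N T : Finset V} {v v' : V} (hv' : v' ∈ S) (hvv' : G.Adj v v') (hN : v' ∉ N)
    (hNS : ∀ w, w ∈ N ↔ w ∈ S ∧ G.Adj v w ∧ w ≠ v') (hT : ∀ x ∈ T, x ∉ S ∧ G.Adj v x)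
    (hg : ∀ w ∈ N, g w = f w) (hcard : 2 * N.card + T.card + 1 ≤ c)
    (hadm : T = ∅ → AdmitsColor f N (g v')) :
    HasUniqueColorOn G g S v ∨
      (∃ x, x ∉ S ∧ G.Adj v x) ∧ 4 * (colorsAround G g S v).card ≤ c := by
  classical
  have hcases : ∀ w ∈ S, G.Adj v w → w = v' ∨ w ∈ N := fun w hw hvw => by
    rw [hNS]; tauto
  by_cases hTe : T = ∅
  · left
    rcases hadm hTe with ⟨u, hu, hne, huniq⟩ | hall
    · refine ⟨u, ((hNS u).1 hu).1, ((hNS u).1 hu).2.1, fun w hw hvw hwu => ?_⟩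
      rw [hg u hu] at hwu
      rcases hcases w hw hvw with rfl | hwN
      · exact absurd hwu.symm hne
      · exact huniq w hwN (by rwa [hg w hwN] at hwu)
    · refine ⟨v', hv', hvv', fun w hw hvw hwu => ?_⟩
      rcases hcases w hw hvw with rfl | hwN
      · rfl
      · exact absurd (by rwa [hg w hwN] at hwu) (hall w hwN)
  · by_cases hu : HasUniqueColorOn G g S v
    · exact Or.inl hu
    obtain ⟨x, hx⟩ := Finset.nonempty_iff_ne_empty.2 hTe
    refine Or.inr ⟨⟨x, hT x hx⟩, ?_⟩
    have hT1 := Finset.card_pos.2 ⟨x, hx⟩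
    have hfilter : S.filter (G.Adj v) = insert v' N := by
      ext w
      simp only [Finset.mem_filter, Finset.mem_insert]
      refine ⟨fun hw => hcases w hw.1 hw.2, ?_⟩
      rintro (rfl | hw)
      · exact ⟨hv', hvv'⟩
      · exact ⟨((hNS w).1 hw).1, ((hNS w).1 hw).2.1⟩
    have himage := two_mul_card_image_le (S.filter (G.Adj v)) g fun u hu' => by
      by_contra! hcon
      rw [Finset.mem_filter] at hu'
      exact hu ⟨u, hu'.1, hu'.2, fun w hw hvw hwu => hcon w (by simp [hw, hvw]) hwu⟩
    have hc2 := Finset.card_insert_of_notMem hN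
    have hcol : (colorsAround G g S v).card = ((S.filter (G.Adj v)).image g).card := by
      unfold colorsAround
      congr!
    rw [hfilter] at himage hcol
    omega

end Counting

/-- For `c ≥ 5`, if `v₁` and `v₂` are adjacent `3⁺`-vertices of a `c`-PCF-critical
graph with `2·deg(vᵢ) - n₂(vᵢ) - 2 ≤ c - i` for `i ∈ {1,2}`, then `v₁` is a
`4⁺`-vertex and one of `v₁, v₂` has no `2`-neighbor. -/
theorem combine_lemma {c : ℕ} (hc : 5 ≤ c) {V : Type*} [Fintype V]
    (G : SimpleGraph V) [DecidableRel G.Adj] (hG : PCFCritical G c)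
    (v₁ v₂ : V) (hadj : G.Adj v₁ v₂)
    (h₁ : 3 ≤ G.degree v₁) (h₂ : 3 ≤ G.degree v₂)
    (hineq₁ : (2 * G.degree v₁ : ℤ) - nDeg G v₁ 2 - 2 ≤ (c : ℤ) - 1)
    (hineq₂ : (2 * G.degree v₂ : ℤ) - nDeg G v₂ 2 - 2 ≤ (c : ℤ) - 2) :
    4 ≤ G.degree v₁ ∧ (nDeg G v₁ 2 = 0 ∨ nDeg G v₂ 2 = 0) := by
  classical
  by_contra hcon
  have : NeZero c := ⟨by omega⟩
  let T : V → Finset V := fun v => (G.neighborFinset v).filter (G.degree · = 2)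
  let N : V → V → Finset V := fun v v' => ((G.neighborFinset v).filter (G.degree · ≠ 2)).erase v'
  have hT : ∀ v x, x ∈ T v ↔ G.Adj v x ∧ G.degree x = 2 := by simp [T]
  have hN : ∀ v v' x, x ∈ N v v' ↔ x ≠ v' ∧ G.Adj v x ∧ G.degree x ≠ 2 := by simp [N]
  have hTcard : ∀ v, nDeg G v 2 = (T v).card := fun v => by
    rw [nDeg, ← Set.ncard_coe_finset]
    congr 1
    ext x
    simp [hT]
  have hdeg : ∀ v v', G.Adj v v' → 3 ≤ G.degree v' →
      G.degree v = (N v v').card + (T v).card + 1 := fun v v' hvv' hv' => by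
    have hsum := Finset.card_filter_add_card_filter_not (s := G.neighborFinset v) (G.degree · = 2)
    have herase := Finset.card_erase_add_one
      (s := (G.neighborFinset v).filter (G.degree · ≠ 2)) (a := v') (by simp [hvv']; omega)
    rw [SimpleGraph.card_neighborFinset_eq_degree] at hsum
    simp only [T, N]
    simp only [ne_eq] at herase ⊢
    omega
  have hd₁ := hdeg v₁ v₂ hadj h₂
  have hd₂ := hdeg v₂ v₁ hadj.symm h₁
  rw [hTcard] at hineq₁ hineq₂
  rw [hTcard, hTcard] at hcon
  set U : Finset V := (T v₁ ∪ T v₂)ᶜ with hU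
  set S : Finset V := (U.erase v₁).erase v₂ with hS
  have hmemU : ∀ z, z ∈ U ↔ ¬ (G.degree z = 2 ∧ (G.Adj v₁ z ∨ G.Adj v₂ z)) := fun z => by
    rw [hU, Finset.mem_compl, Finset.mem_union, hT, hT, ← or_and_right, and_comm]
  have hmemS : ∀ z, z ∈ S ↔ z ≠ v₂ ∧ z ≠ v₁ ∧ z ∈ U := by simp [hS]
  have hv₁U : v₁ ∈ U := (hmemU v₁).2 (by omega)
  have hv₂U : v₂ ∈ U := (hmemU v₂).2 (by omega)
  obtain ⟨f, hproper, huniq⟩ := hG.exists_coloring_on S (x := v₁) (by simp [hmemS])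
  have hφ : ∀ v, ∃ b : Fin c, v ∈ S → (∃ u ∈ S, G.Adj v u) →
      ∃ u ∈ S, G.Adj v u ∧ f u = b ∧ ∀ w ∈ S, G.Adj v w → f w = f u → w = u := fun v => by
    by_cases h : v ∈ S ∧ ∃ u ∈ S, G.Adj v u
    · obtain ⟨u, hu, hvu, hw⟩ := huniq v h.1 h.2
      exact ⟨f u, fun _ _ => ⟨u, hu, hvu, rfl, hw⟩⟩
    · exact ⟨0, fun h1 h2 => absurd ⟨h1, h2⟩ h⟩
  choose φ hφ using hφ
  obtain ⟨F₁, hF₁, hF₁', hN₁, hT₁⟩ :=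
    exists_forbidden_colors G f φ v₁ (N v₁ v₂) (T v₁) fun x => (hT v₁ x).1
  obtain ⟨F₂, hF₂, -, hN₂, hT₂⟩ :=
    exists_forbidden_colors G f φ v₂ (N v₂ v₁) (T v₂) fun x => (hT v₂ x).1
  obtain ⟨a₁, a₂, hne, ha₁, ha₂, hadm₁, hadm₂⟩ := exists_color_pair hc f hF₁ hF₂ hF₁'
    (by omega) (by omega) (by omega) (by omega)
  let g : V → Fin c := Function.update (Function.update f v₂ a₂) v₁ a₁
  have hg₁ : g v₁ = a₁ := by simp [g]
  have hg₂ : g v₂ = a₂ := by simp [g, hadj.ne']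
  have hg : ∀ z, z ≠ v₁ → z ≠ v₂ → g z = f z := fun z hz₁ hz₂ => by simp [g, hz₁, hz₂]
  have hgS : ∀ z ∈ S, g z = f z := fun z hz =>
    hg z ((hmemS z).1 hz).2.1 ((hmemS z).1 hz).1
  have hmemN₁ : ∀ w, w ∈ N v₁ v₂ ↔ w ∈ U ∧ G.Adj v₁ w ∧ w ≠ v₂ := fun w => by
    rw [hN, hmemU]
    exact ⟨fun ⟨h, ha, hd⟩ => ⟨fun h' => hd h'.1, ha, h⟩,
      fun ⟨h', ha, h⟩ => ⟨h, ha, fun hd => h' ⟨hd, Or.inl ha⟩⟩⟩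
  have hmemN₂ : ∀ w, w ∈ N v₂ v₁ ↔ w ∈ U ∧ G.Adj v₂ w ∧ w ≠ v₁ := fun w => by
    rw [hN, hmemU]
    exact ⟨fun ⟨h, ha, hd⟩ => ⟨fun h' => hd h'.1, ha, h⟩,
      fun ⟨h', ha, h⟩ => ⟨h, ha, fun hd => h' ⟨hd, Or.inr ha⟩⟩⟩
  have hSN₁ : ∀ w ∈ S, G.Adj v₁ w → w ∈ N v₁ v₂ := fun w hw h =>
    (hmemN₁ w).2 ⟨((hmemS w).1 hw).2.2, h, ((hmemS w).1 hw).1⟩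
  have hSN₂ : ∀ w ∈ S, G.Adj v₂ w → w ∈ N v₂ v₁ := fun w hw h =>
    (hmemN₂ w).2 ⟨((hmemS w).1 hw).2.2, h, ((hmemS w).1 hw).2.1⟩
  have hcases : ∀ z ∈ U, z = v₁ ∨ z = v₂ ∨ z ∈ S := fun z hz => by
    by_cases hz₁ : z = v₁
    · exact Or.inl hz₁
    by_cases hz₂ : z = v₂
    · exact Or.inr (Or.inl hz₂)
    exact Or.inr (Or.inr ((hmemS z).2 ⟨hz₂, hz₁, hz⟩))
  have hne₁ : ∀ w ∈ S, G.Adj v₁ w → a₁ ≠ f w := by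
    rintro w hw h rfl; exact ha₁ (hN₁ w (hSN₁ w hw h)).1
  have hne₂ : ∀ w ∈ S, G.Adj v₂ w → a₂ ≠ f w := by
    rintro w hw h rfl; exact ha₂ (hN₂ w (hSN₂ w hw h)).1
  refine hG.1 (IsAlmostPCFOn.exists_isPCFColoring (f := g) (S := U) hc ⟨?_, ?_, ?_⟩)
  · intro u hu v hv huv
    rcases hcases u hu with rfl | rfl | hu <;> rcases hcases v hv with rfl | rfl | hv
    · exact absurd huv (G.loopless.irrefl _)
    · rwa [hg₁, hg₂]
    · rw [hg₁, hgS v hv]; exact hne₁ v hv huv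
    · rw [hg₁, hg₂]; exact hne.symm
    · exact absurd huv (G.loopless.irrefl _)
    · rw [hg₂, hgS v hv]; exact hne₂ v hv huv
    · rw [hg₁, hgS u hu]; exact (hne₁ u hu huv.symm).symm
    · rw [hg₂, hgS u hu]; exact (hne₂ u hu huv.symm).symm
    · rw [hgS u hu, hgS v hv]; exact hproper u hu v hv huv
  · rintro v hv ⟨x, hvx⟩
    rcases hcases v hv with rfl | rfl | hvS
    · refine hasUniqueColorOn_or_of_admitsColor (f := f) (N := N v v₂) (T := T v) hv₂U hadj
        (by simp [hN]) hmemN₁ (fun x hx => ?_) (fun w hw => ?_) (by omega) (by rwa [hg₂])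
      · rw [hT] at hx
        exact ⟨fun h => (hmemU x).1 h ⟨hx.2, Or.inl hx.1⟩, hx.1⟩
      · rw [hmemN₁] at hw; exact hg w hw.2.1.ne' hw.2.2
    · refine hasUniqueColorOn_or_of_admitsColor (f := f) (N := N v v₁) (T := T v) hv₁U hadj.symm
        (by simp [hN]) hmemN₂ (fun x hx => ?_) (fun w hw => ?_) (by omega) (by rwa [hg₁])
      · rw [hT] at hx
        exact ⟨fun h => (hmemU x).1 h ⟨hx.2, Or.inr hx.1⟩, hx.1⟩
      · rw [hmemN₂] at hw; exact hg w hw.2.2 hw.2.1.ne'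
    · by_cases hn : ∃ u ∈ S, G.Adj v u
      · obtain ⟨u, hu, hvu, hub, huu⟩ := hφ v hvS hn
        refine Or.inl ⟨u, ((hmemS u).1 hu).2.2, hvu, fun w hw hvw hwu => ?_⟩
        rw [hgS u hu] at hwu
        rcases hcases w hw with rfl | rfl | hwS
        · rw [hg₁, hub] at hwu
          exact absurd (hwu ▸ (hN₁ v (hSN₁ v hvS hvw.symm)).2) ha₁
        · rw [hg₂, hub] at hwu
          exact absurd (hwu ▸ (hN₂ v (hSN₂ v hvS hvw.symm)).2) ha₂
        · rw [hgS w hwS] at hwu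
          exact huu w hwS hvw hwu
      · have hclose : ∀ w ∈ U, G.Adj v w → w = v₁ ∨ w = v₂ := fun w hw hvw => by
          rcases hcases w hw with h | h | h
          · exact Or.inl h
          · exact Or.inr h
          · exact absurd ⟨w, h, hvw⟩ hn
        by_cases hn' : ∃ u ∈ U, G.Adj v u
        · obtain ⟨u, hu, hvu⟩ := hn'
          refine Or.inl ⟨u, hu, hvu, fun w hw hvw hwu => ?_⟩
          rcases hclose u hu hvu with rfl | rfl <;> rcases hclose w hw hvw with rfl | rfl
          · rfl
          · rw [hg₁, hg₂] at hwu; exact absurd hwu.symm hne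
          · rw [hg₁, hg₂] at hwu; exact absurd hwu hne
          · rfl
        · refine Or.inr ⟨⟨x, fun hx => hn' ⟨x, hx, hvx⟩, hvx⟩, ?_⟩
          simp [colorsAround_eq_empty hn']
  · intro x hx
    rw [hmemU, not_not] at hx
    obtain ⟨hx2, hx⟩ := hx
    have hnbr : ∀ y, G.Adj x y → y ∈ U := fun y hxy =>
      (hmemU y).2 fun h => hG.degree_ne_two_of_adj hc hxy hx2 h.1
    rcases hx with hx | hx
    · obtain ⟨y, hxy, hyv, hM⟩ := exists_other_neighbor hx2 hx.symm
      refine ⟨v₁, hv₁U, y, hnbr y hxy, hx.symm, hxy, ?_, hM⟩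
      by_cases hy : y = v₂
      · rwa [hy, hg₁, hg₂]
      · rw [hg₁, hg y hyv hy]
        rintro rfl
        exact ha₁ (hT₁ x ((hT _ _).2 ⟨hx, hx2⟩) y hxy hyv)
    · obtain ⟨y, hxy, hyv, hM⟩ := exists_other_neighbor hx2 hx.symm
      refine ⟨v₂, hv₂U, y, hnbr y hxy, hx.symm, hxy, ?_, hM⟩
      by_cases hy : y = v₁
      · rw [hy, hg₁, hg₂]; exact hne.symm
      · rw [hg₂, hg y hy hyv]
        rintro rfl
        exact ha₂ (hT₂ x ((hT _ _).2 ⟨hx, hx2⟩) y hxy hyv)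
end

section
/- For every integer c ≥ 5, if v is a vertex of a c-PCF-critical graph G and v has at least one neighbor of degree 2, then 2·deg(v) ≥ n₂(v) + c. -/
open SimpleGraph

namespace SimpleGraph

variable {V : Type*} {c : ℕ}

/-- Some color appears exactly once on the neighbors of `u` in `A`, provided there are any. -/
def ConflictFreeAt (G : SimpleGraph V) (A : Set V) (f : V → Fin c) (u : V) : Prop :=
  (∃ x ∈ A, G.Adj u x) → ∃ x ∈ A, G.Adj u x ∧ ∀ y ∈ A, G.Adj u y → f y = f x → y = x

/-- `f` is proper on `A`, and conflict-free with respect to `A` at every vertex other than `v`. -/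
def PartialPCF (G : SimpleGraph V) (v : V) (A : Set V) (f : V → Fin c) : Prop :=
  (∀ x ∈ A, ∀ y ∈ A, G.Adj x y → f x ≠ f y) ∧ ∀ u, u ≠ v → G.ConflictFreeAt A f u

open Classical in
theorem ConflictFreeAt.insert_of_not_adj {G : SimpleGraph V} {A : Set V} {f : V → Fin c}
    {u w : V} (h : G.ConflictFreeAt A f u) (huw : ¬ G.Adj u w) (a : Fin c) :
    G.ConflictFreeAt (insert w A) (Function.update f w a) u := by
  have ne : ∀ x, G.Adj u x → x ≠ w := fun x hx e => huw (e ▸ hx)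
  rintro ⟨x, hx, hux⟩
  obtain ⟨y, hy, huy, hyu⟩ := h ⟨x, hx.resolve_left (ne x hux), hux⟩
  refine ⟨y, Or.inr hy, huy, fun z hz huz e => hyu z (hz.resolve_left (ne z huz)) huz ?_⟩
  rwa [Function.update_of_ne (ne z huz), Function.update_of_ne (ne y huy)] at e

open Classical in
/-- Coloring a further vertex spoils conflict-freeness at `u` for at most one choice of color. -/
theorem ConflictFreeAt.exists_insert {G : SimpleGraph V} {A : Set V} {f : V → Fin c}
    {u w : V} (h : G.ConflictFreeAt A f u) (hw : w ∉ A) :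
    ∃ b : Fin c, ∀ a ≠ b, G.ConflictFreeAt (insert w A) (Function.update f w a) u := by
  by_cases hn : ∃ x ∈ A, G.Adj u x
  · obtain ⟨y, hy, huy, hyu⟩ := h hn
    have hyw : y ≠ w := fun e => hw (e ▸ hy)
    refine ⟨f y, fun a ha _ => ⟨y, Or.inr hy, huy, fun z hz huz e => ?_⟩⟩
    rw [Function.update_of_ne hyw] at e
    by_cases hzw : z = w
    · subst hzw
      simp [ha] at e
    · rw [Function.update_of_ne hzw] at e
      exact hyu z (hz.resolve_left hzw) huz e
  · refine ⟨f w, fun a _ => ?_⟩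
    have key : ∀ x ∈ insert w A, G.Adj u x → x = w := fun x hx hux =>
      hx.resolve_right fun hA => hn ⟨x, hA, hux⟩
    rintro ⟨x, hx, hux⟩
    exact ⟨x, hx, hux, fun y hy huy _ => (key y hy huy).trans (key x hx hux).symm⟩

variable [Fintype V]

open Classical in
/-- A partial coloring extends to `w`, avoiding a set `F` of colors, as soon as the colors
excluded by properness, by conflict-freeness at the neighbors of `w` and by `F` do not exhaust
the palette. -/
theorem PartialPCF.exists_insert {G : SimpleGraph V} {v : V} {A : Set V} {f : V → Fin c}
    [DecidableRel G.Adj] (h : G.PartialPCF v A f) {w : V} (hw : w ∉ A) (F : Finset (Fin c))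
    (hF : ((G.neighborFinset w).filter (· ≠ v)).card +
      ((G.neighborFinset w).filter (· ∈ A)).card + F.card < c) :
    ∃ a ∉ F, G.PartialPCF v (insert w A) (Function.update f w a) := by
  have hb : ∀ u, ∃ b : Fin c, u ≠ v → ∀ a ≠ b,
      G.ConflictFreeAt (insert w A) (Function.update f w a) u := by
    intro u
    by_cases hu : u = v
    · exact ⟨f w, fun h' => absurd hu h'⟩
    · obtain ⟨b, hb⟩ := (h.2 u hu).exists_insert hw
      exact ⟨b, fun _ => hb⟩
  choose b hb using hb
  obtain ⟨a, ha⟩ : ∃ a, a ∉ ((G.neighborFinset w).filter (· ≠ v)).image b ∪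
      ((G.neighborFinset w).filter (· ∈ A)).image f ∪ F := by
    by_contra! hall
    have hc := Finset.card_le_card (fun x _ => hall x : Finset.univ ⊆ _)
    have h1 := Finset.card_union_le (((G.neighborFinset w).filter (· ≠ v)).image b ∪
      ((G.neighborFinset w).filter (· ∈ A)).image f) F
    have h2 := Finset.card_union_le (((G.neighborFinset w).filter (· ≠ v)).image b)
      (((G.neighborFinset w).filter (· ∈ A)).image f)
    have h3 : (((G.neighborFinset w).filter (· ≠ v)).image b).card ≤ _ := Finset.card_image_le
    have h4 : (((G.neighborFinset w).filter (· ∈ A)).image f).card ≤ _ := Finset.card_image_le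
    rw [Finset.card_univ, Fintype.card_fin] at hc
    omega
  simp only [Finset.mem_union, Finset.mem_image, Finset.mem_filter, mem_neighborFinset,
    not_or, not_exists, not_and] at ha
  obtain ⟨⟨hab, haf⟩, haF⟩ := ha
  refine ⟨a, haF, ?_, fun u hu => ?_⟩
  · have ne : ∀ x ∈ A, x ≠ w := fun x hx e => hw (e ▸ hx)
    rintro x (rfl | hx) y (rfl | hy) hxy
    · exact absurd hxy (G.irrefl)
    · rw [Function.update_self, Function.update_of_ne (ne y hy)]
      exact fun e => haf y ⟨hxy, hy⟩ e.symm
    · rw [Function.update_self, Function.update_of_ne (ne x hx)]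
      exact haf x ⟨hxy.symm, hx⟩
    · rw [Function.update_of_ne (ne x hx), Function.update_of_ne (ne y hy)]
      exact h.1 x hx y hy hxy
  · by_cases huw : G.Adj u w
    · exact hb u hu a fun e => hab u ⟨huw.symm, hu⟩ e.symm
    · exact (h.2 u hu).insert_of_not_adj huw a

open Classical in
/-- A set of fewer than half of `deg v` colors, or a single color, whose avoidance at the
neighbor `w` guarantees conflict-freeness at `v`. -/
theorem exists_forbidden_conflictFreeAt (G : SimpleGraph V) [DecidableRel G.Adj] {v w : V} {A : Set V}
    (f : V → Fin c) (hw : w ∉ A) (hvw : G.Adj v w) :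
    ∃ F : Finset (Fin c), (F.card ≤ 1 ∨ 2 * F.card + 1 ≤ G.degree v) ∧
      ∀ a ∉ F, G.ConflictFreeAt (insert w A) (Function.update f w a) v := by
  by_cases hs : G.ConflictFreeAt A f v
  · obtain ⟨b, hb⟩ := hs.exists_insert hw
    exact ⟨{b}, by simp, fun a ha => hb a (by simpa using ha)⟩
  · set N := (G.neighborFinset v).filter (· ∈ A) with hN
    refine ⟨N.image f, Or.inr ?_, fun a ha _ => ⟨w, Or.inl rfl, hvw, fun y hy hvy e => ?_⟩⟩
    · have h1 : 2 * (N.image f).card ≤ N.card := by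
        refine Finset.mul_card_image_le_card N 2 fun b hb => ?_
        obtain ⟨x, hx, rfl⟩ := Finset.mem_image.1 hb
        by_contra! hlt
        have hxN : x ∈ A ∧ G.Adj v x := by simpa [hN, and_comm] using hx
        refine hs fun _ => ⟨x, hxN.1, hxN.2, fun y hy hvy e => ?_⟩
        exact Finset.card_le_one.1 (Nat.le_of_lt_succ hlt) y (by simp [hN, hy, hvy, e])
          x (by simp [hx])
      have h2 : N.card < (G.neighborFinset v).card := by
        refine Finset.card_lt_card ⟨Finset.filter_subset _ _, fun hsub => ?_⟩
        have := hsub ((G.mem_neighborFinset v w).2 hvw)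
        simp [hN, hw] at this
      rw [card_neighborFinset_eq_degree] at h2
      omega
    · by_contra hyw
      rw [Function.update_self, Function.update_of_ne hyw] at e
      refine ha (Finset.mem_image.2 ⟨y, ?_, e⟩)
      simp [hN, hvy, hy.resolve_left hyw]

open Classical in
/-- A critical graph minus a vertex `v` and its neighbors of degree two has a partial coloring. -/
theorem exists_partialPCF_of_critical {G : SimpleGraph V} [DecidableRel G.Adj] (hc : 0 < c)
    (hG : PCFCritical G c) (v : V) :
    ∃ f : V → Fin c, G.PartialPCF v {u | u ≠ v ∧ ¬ (G.Adj v u ∧ G.degree u = 2)} f := by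
  set A : Set V := {u | u ≠ v ∧ ¬ (G.Adj v u ∧ G.degree u = 2)} with hA
  obtain ⟨g, hg⟩ := hG.2 ((⊤ : G.Subgraph).induce A) (fun h => by
    have : v ∈ ((⊤ : G.Subgraph).induce A).verts := by rw [h]; trivial
    exact this.1 rfl)
  refine ⟨fun x => if hx : x ∈ A then g ⟨x, hx⟩ else ⟨0, hc⟩, fun x hx y hy hxy => ?_,
    fun u hu hex => ?_⟩
  · simp only [hx, hy, dif_pos]
    exact hg.1 (by simpa using ⟨hx, hy, hxy⟩)
  · obtain ⟨x, hx, hux⟩ := hex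
    by_cases huA : u ∈ A
    · obtain ⟨⟨y, hy⟩, huy, hyu⟩ := hg.2 ⟨u, huA⟩ ⟨⟨x, hx⟩, by simpa using ⟨huA, hx, hux⟩⟩
      simp only [Subgraph.coe_adj, Subgraph.induce_adj, Subgraph.top_adj] at huy
      refine ⟨y, hy, huy.2.2, fun z hz huz e => ?_⟩
      have hy' : y ∈ A := hy
      simp only [hz, hy', dif_pos] at e
      exact congrArg Subtype.val (hyu ⟨z, hz⟩ (by simpa using ⟨huA, hz, huz⟩) e)
    · have hu2 : G.Adj v u ∧ G.degree u = 2 := by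
        by_contra h'
        exact huA ⟨hu, h'⟩
      refine ⟨x, hx, hux, fun y hy huy _ => ?_⟩
      by_contra hyx
      have hsub : ({v, x, y} : Finset V) ⊆ G.neighborFinset u := by
        intro z hz
        simp only [Finset.mem_insert, Finset.mem_singleton] at hz
        rcases hz with rfl | rfl | rfl
        · simpa using hu2.1.symm
        · simpa using hux
        · simpa using huy
      have hcard := Finset.card_le_card hsub
      rw [card_neighborFinset_eq_degree, hu2.2,
        Finset.card_eq_three.2 ⟨v, x, y, hx.1.symm, hy.1.symm, Ne.symm hyx, rfl⟩] at hcard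
      omega

open Classical in
/-- The colors of `v` and of the second neighbor of a degree-two neighbor `w` of `v` cost three
choices in all at `w`. -/
theorem card_filter_neighborFinset_le_three {G : SimpleGraph V} [DecidableRel G.Adj]
    {v w : V} (hvw : G.Adj v w) (hw : G.degree w = 2) (A : Set V) :
    ((G.neighborFinset w).filter (· ≠ v)).card +
      ((G.neighborFinset w).filter (· ∈ A)).card ≤ 3 := by
  have h1 : ((G.neighborFinset w).filter (· ∈ A)).card ≤ _ := Finset.card_filter_le _ _
  have h2 : ((G.neighborFinset w).filter (· ≠ v)).card < (G.neighborFinset w).card := by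
    refine Finset.card_lt_card ⟨Finset.filter_subset _ _, fun hsub => ?_⟩
    have := hsub ((G.mem_neighborFinset w v).2 hvw.symm)
    simp at this
  rw [card_neighborFinset_eq_degree, hw] at h1 h2
  omega

end SimpleGraph

/-- For `c ≥ 5`, if `v` is a vertex of a `c`-PCF-critical graph with a
`2`-neighbor, then `2·deg(v) ≥ n₂(v) + c`. -/
theorem two_neighbor_degree_bound {c : ℕ} (hc : 5 ≤ c) {V : Type*} [Fintype V]
    (G : SimpleGraph V) [DecidableRel G.Adj] (hG : PCFCritical G c)
    (v : V) (hv : ∃ u, G.Adj v u ∧ G.degree u = 2) :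
    nDeg G v 2 + c ≤ 2 * G.degree v := by
  classical
  by_contra! hlt
  obtain ⟨w, hvw, hw2⟩ := hv
  set S := (G.neighborFinset v).filter (fun u => G.degree u = 2) with hS
  have memS : ∀ u, u ∈ S ↔ G.Adj v u ∧ G.degree u = 2 := by simp [hS]
  have hn : nDeg G v 2 = S.card := by
    rw [nDeg, ← Set.ncard_coe_finset]
    congr 1
    ext u
    simp [memS]
  have hSN : S ⊆ G.neighborFinset v := Finset.filter_subset _ _
  have hSle : S.card ≤ G.degree v := G.card_neighborFinset_eq_degree v ▸ Finset.card_le_card hSN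
  obtain ⟨A, hA⟩ : ∃ A : Set V, A = {u | u ≠ v ∧ u ∉ S} := ⟨_, rfl⟩
  obtain ⟨f₀, hf₀⟩ : ∃ f : V → Fin c, G.PartialPCF v A f := by
    obtain ⟨f, hf⟩ := SimpleGraph.exists_partialPCF_of_critical (by omega) hG v
    refine ⟨f, ?_⟩
    simpa only [hA, memS] using hf
  have extend : ∀ T : Finset V, T ⊆ S.erase w →
      ∃ f : V → Fin c, G.PartialPCF v (insert v A ∪ T) f := by
    intro T
    induction T using Finset.induction_on with
    | empty =>
      intro _
      obtain ⟨a, -, ha⟩ := hf₀.exists_insert (w := v) (by simp [hA]) ∅ (by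
        have h1 : ((G.neighborFinset v).filter (· ≠ v)).card ≤ _ := Finset.card_filter_le _ _
        have h2 : (G.neighborFinset v).filter (· ∈ A) ⊆ G.neighborFinset v \ S := by
          intro x hx
          simp only [Finset.mem_filter, hA, Set.mem_ofPred_eq] at hx
          exact Finset.mem_sdiff.2 ⟨hx.1, hx.2.2⟩
        have h3 := Finset.card_le_card h2
        rw [Finset.card_sdiff_of_subset hSN] at h3
        rw [G.card_neighborFinset_eq_degree] at h1 h3
        rw [Finset.card_empty]
        omega)
      exact ⟨_, by simpa using ha⟩
    | insert t T ht ih =>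
      intro hT
      obtain ⟨f, hf⟩ := ih ((Finset.subset_insert _ _).trans hT)
      have htS : t ∈ S := Finset.mem_of_mem_erase (hT (Finset.mem_insert_self _ _))
      obtain ⟨htv, ht2⟩ := (memS t).1 htS
      obtain ⟨a, -, ha⟩ := hf.exists_insert (w := t)
        (by simp [hA, ht, htS, htv.ne']) ∅ (by
          have := SimpleGraph.card_filter_neighborFinset_le_three htv ht2
            (insert v A ∪ T)
          rw [Finset.card_empty]
          omega)
      exact ⟨_, by simpa [Set.union_insert] using ha⟩
  obtain ⟨f, hf⟩ := extend _ subset_rfl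
  have hwA : w ∉ insert v A ∪ (S.erase w : Finset V) := by
    simp [hA, memS, hvw, hw2, hvw.ne']
  obtain ⟨F, hF, hFv⟩ := G.exists_forbidden_conflictFreeAt f hwA hvw
  obtain ⟨a, haF, ha⟩ := hf.exists_insert hwA F (by
    have := SimpleGraph.card_filter_neighborFinset_le_three hvw hw2
      (insert v A ∪ (S.erase w : Finset V))
    omega)
  have huniv : insert w (insert v A ∪ (S.erase w : Finset V)) = Set.univ := by
    ext x
    simp only [hA, Set.mem_insert_iff, Set.mem_union, Set.mem_ofPred_eq, Finset.mem_coe,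
      Finset.mem_erase, Set.mem_univ, iff_true]
    tauto
  have hall := hFv a haF
  rw [huniv] at ha hall
  refine hG.1 ⟨_, fun x y hxy => ha.1 x trivial y trivial hxy, fun u hu => ?_⟩
  have hcf : G.ConflictFreeAt Set.univ (Function.update f w a) u := by
    by_cases huv : u = v
    · exact huv ▸ hall
    · exact ha.2 u huv
  simpa [SimpleGraph.ConflictFreeAt, hu] using hcf
end

section
/- Every finite simple graph G with mad(G) < 2 has a proper conflict-free 3-coloring, i.e., χ_pcf(G) ≤ 3. (In particular, every tree has a PCF 3-coloring, obtained by coloring each vertex by its distance modulo 3 from a fixed vertex.) -/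
open SimpleGraph

/-- A nonempty subgraph of a finite graph with `mad < 2` has a vertex with at most one neighbor. -/
theorem MadLT.exists_neighborSet_subsingleton {V : Type*} [Fintype V] {G : SimpleGraph V}
    (hmad : MadLT G 2) (H : G.Subgraph) (hH : H.verts.Nonempty) :
    ∃ v ∈ H.verts, (H.neighborSet v).Subsingleton := by
  classical
  by_contra! hcon
  have hdeg : ∀ v ∈ H.verts.toFinset, 2 ≤ H.spanningCoe.degree v := fun v hv => by
    obtain ⟨a, ha, b, hb, hab⟩ := hcon v (Set.mem_toFinset.mp hv)
    exact Finset.one_lt_card.mpr ⟨a, (mem_neighborFinset _ _ _).mpr ha, b,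
      (mem_neighborFinset _ _ _).mpr hb, hab⟩
  have hsum : H.verts.ncard * 2 ≤ 2 * H.edgeSet.ncard := by
    have hedge : H.edgeSet.ncard = H.spanningCoe.edgeFinset.card := by
      rw [← Set.ncard_coe_finset, coe_edgeFinset]
      rfl
    rw [hedge, ← H.spanningCoe.sum_degrees_eq_twice_card_edges, Set.ncard_eq_toFinset_card']
    calc H.verts.toFinset.card * 2
        ≤ ∑ v ∈ H.verts.toFinset, H.spanningCoe.degree v :=
          Finset.card_nsmul_le_sum _ _ _ hdeg
      _ ≤ ∑ v, H.spanningCoe.degree v :=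
          Finset.sum_le_sum_of_subset (Finset.subset_univ _)
  have hlt : 2 * H.edgeSet.ncard < 2 * H.verts.ncard := by exact_mod_cast hmad H hH
  lia

/-- A PCF 3-coloring of a graph extends over an additional vertex with at most one neighbor. -/
theorem IsPCFColoring.exists_extend_pendant {V : Type*} {G G' : SimpleGraph V} {v : V}
    (hv : (G.neighborSet v).Subsingleton) (hv' : ∀ a, ¬ G'.Adj v a)
    (hadj : ∀ a b, a ≠ v → b ≠ v → (G'.Adj a b ↔ G.Adj a b))
    {f : V → Fin 3} (hf : IsPCFColoring G' f) :
    ∃ g : V → Fin 3, IsPCFColoring G g := by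
  classical
  obtain ⟨c, hc, hcu⟩ : ∃ c : Fin 3, (∀ u, G.Adj v u → c ≠ f u) ∧
      ∀ u, G.Adj v u → (∃ w, G'.Adj u w) →
        ∃ w, G'.Adj u w ∧ c ≠ f w ∧ ∀ x, G'.Adj u x → f x = f w → x = w := by
    have third : ∀ a b : Fin 3, ∃ c, c ≠ a ∧ c ≠ b := by decide
    by_cases h : ∃ u, G.Adj v u
    · obtain ⟨u, hu⟩ := h
      have huniq : ∀ u', G.Adj v u' → u' = u := fun u' h' => hv h' hu
      by_cases hw : ∃ w, G'.Adj u w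
      · obtain ⟨w, huw, hw⟩ := hf.2 u hw
        obtain ⟨c, hcu, hcw⟩ := third (f u) (f w)
        refine ⟨c, fun u' h' => huniq u' h' ▸ hcu, fun u' h' _ => ?_⟩
        rw [huniq u' h']
        exact ⟨w, huw, hcw, hw⟩
      · obtain ⟨c, hcu, -⟩ := third (f u) (f u)
        exact ⟨c, fun u' h' => huniq u' h' ▸ hcu, fun u' h' h => absurd (huniq u' h' ▸ h) hw⟩
    · exact ⟨0, fun u hu => absurd ⟨u, hu⟩ h, fun u hu => absurd ⟨u, hu⟩ h⟩
  have hne : ∀ {a b}, G'.Adj a b → a ≠ v ∧ b ≠ v := fun {a b} hab =>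
    ⟨fun h => hv' b (h ▸ hab), fun h => hv' a (h ▸ hab.symm)⟩
  refine ⟨Function.update f v c, fun a b hab => ?_, fun a ⟨b, hab⟩ => ?_⟩
  · by_cases ha : a = v
    · subst ha
      simpa [hab.ne'] using hc b hab
    · by_cases hb : b = v
      · subst hb
        simpa [ha] using (hc a hab.symm).symm
      · simpa [ha, hb] using hf.1 ((hadj a b ha hb).mpr hab)
  · by_cases ha : a = v
    · subst ha
      exact ⟨b, hab, fun w hw _ => hv hw hab⟩
    · by_cases hnb : ∃ w, G'.Adj a w
      · obtain ⟨w, haw, hcw, hw⟩ : ∃ w, G'.Adj a w ∧ (G.Adj v a → c ≠ f w) ∧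
            ∀ x, G'.Adj a x → f x = f w → x = w := by
          by_cases hva : G.Adj v a
          · obtain ⟨w, haw, hcw, hw⟩ := hcu a hva hnb
            exact ⟨w, haw, fun _ => hcw, hw⟩
          · obtain ⟨w, haw, hw⟩ := hf.2 a hnb
            exact ⟨w, haw, fun h => absurd h hva, hw⟩
        have hwv := (hne haw).2
        refine ⟨w, (hadj a w ha hwv).mp haw, fun x hax hx => ?_⟩
        by_cases hxv : x = v
        · subst hxv
          exact absurd (by simpa [hwv] using hx) (hcw hax.symm)
        · exact hw x ((hadj a x ha hxv).mpr hax) (by simpa [hwv, hxv] using hx)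
      · have hall : ∀ x, G.Adj a x → x = v := fun x hax => by
          by_contra hxv
          exact hnb ⟨x, (hadj a x ha hxv).mpr hax⟩
        exact ⟨b, hab, fun w hw _ => (hall w hw).trans (hall b hab).symm⟩

/-- Every finite simple graph `G` with `mad(G) < 2` has a proper conflict-free
`3`-coloring. -/
theorem pcf_three_of_madLT_two {V : Type*} [Fintype V] (G : SimpleGraph V)
    (hmad : MadLT G 2) :
    ∃ f : V → Fin 3, IsPCFColoring G f := by
  classical
  have key : ∀ s : Finset V, ∃ f : V → Fin 3,
      IsPCFColoring ((⊤ : G.Subgraph).induce s).spanningCoe f := by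
    intro s
    induction s using Finset.strongInduction with
    | H s ih =>
      rcases s.eq_empty_or_nonempty with rfl | hs
      · exact ⟨0, fun a b hab => by simp at hab, fun a ⟨b, hab⟩ => by simp at hab⟩
      · obtain ⟨v, hvs, hv⟩ :=
          hmad.exists_neighborSet_subsingleton ((⊤ : G.Subgraph).induce s) (by simpa using hs)
        obtain ⟨f, hf⟩ := ih (s.erase v) (Finset.erase_ssubset (by simpa using hvs))
        refine hf.exists_extend_pendant (v := v) (fun a ha b hb => hv ha hb) (by simp) ?_
        intro a b ha hb
        simp [ha, hb]
  obtain ⟨f, hf⟩ := key Finset.univ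
  have hG : ((⊤ : G.Subgraph).induce (Finset.univ : Finset V)).spanningCoe = G := by
    ext a b
    simp
  exact ⟨f, hG ▸ hf⟩
end

section
/- The cycle C₅ on 5 vertices satisfies χ_pcf(C₅) = 5; in particular, C₅ has no proper conflict-free 4-coloring. -/
open SimpleGraph

/-- An injective map is a proper conflict-free coloring of every graph. -/
theorem IsPCFColoring.of_injective {V : Type*} {c : ℕ} (G : SimpleGraph V) {f : V → Fin c}
    (hf : Function.Injective f) : IsPCFColoring G f :=
  ⟨fun _ _ h => hf.ne h.ne, fun _ ⟨u, hu⟩ => ⟨u, hu, fun _ _ h => hf h⟩⟩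

/-- In a proper conflict-free coloring, the two neighbors of a vertex with exactly two
neighbors get different colors. -/
theorem IsPCFColoring.ne_of_neighbors {V : Type*} {c : ℕ} {G : SimpleGraph V} {f : V → Fin c}
    (hf : IsPCFColoring G f) {x u v : V} (hu : G.Adj x u) (hv : G.Adj x v)
    (h : ∀ w, G.Adj x w → w = u ∨ w = v) (huv : u ≠ v) : f u ≠ f v := by
  intro hfuv
  obtain ⟨y, hy, hy'⟩ := hf.2 x ⟨u, hu⟩
  rcases h y hy with rfl | rfl
  · exact huv (hy' v hv hfuv.symm).symm
  · exact huv (hy' u hu hfuv)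

/-- Two distinct vertices of `C₅` are adjacent or are the two neighbors of some vertex. -/
theorem cycleGraph_five_adj_or_neighbors : ∀ u v : Fin 5, u ≠ v →
    (cycleGraph 5).Adj u v ∨ ∃ x, (cycleGraph 5).Adj x u ∧ (cycleGraph 5).Adj x v ∧
      ∀ w, (cycleGraph 5).Adj x w → w = u ∨ w = v := by
  decide

/-- Every proper conflict-free coloring of `C₅` is injective. -/
theorem IsPCFColoring.injective_of_cycleGraph_five {c : ℕ} {f : Fin 5 → Fin c}
    (hf : IsPCFColoring (cycleGraph 5) f) : Function.Injective f := by
  intro u v huv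
  by_contra hne
  rcases cycleGraph_five_adj_or_neighbors u v hne with h | ⟨x, hu, hv, h⟩
  · exact hf.1 h huv
  · exact hf.ne_of_neighbors hu hv h hne huv

/-- The cycle `C₅` satisfies `χ_pcf(C₅) = 5`: it has a PCF `5`-coloring but no
PCF `4`-coloring. -/
theorem pcf_C5 :
    (∃ f : Fin 5 → Fin 5, IsPCFColoring (SimpleGraph.cycleGraph 5) f) ∧
    ¬ ∃ f : Fin 5 → Fin 4, IsPCFColoring (SimpleGraph.cycleGraph 5) f := by
  refine ⟨⟨id, .of_injective _ Function.injective_id⟩, ?_⟩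
  rintro ⟨f, hf⟩
  simpa using Fintype.card_le_of_injective f hf.injective_of_cycleGraph_five
end

section
/- For every integer n ≥ 4 with n ≢ 0 (mod 3), the cycle C_n on n vertices has no proper conflict-free 3-coloring. -/
open SimpleGraph

/-- A PCF coloring of a cycle of length at least `3` gives different colors to the two neighbors
of each vertex. -/
theorem IsPCFColoring.cycleGraph_add_one_ne_sub_one {m c : ℕ} {f : Fin (m + 3) → Fin c}
    (hf : IsPCFColoring (cycleGraph (m + 3)) f) (v : Fin (m + 3)) :
    f (v + 1) ≠ f (v - 1) := by
  intro h
  have hadd : (cycleGraph (m + 3)).Adj v (v + 1) := by simp [cycleGraph_adj]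
  have hsub : (cycleGraph (m + 3)).Adj v (v - 1) := by simp [cycleGraph_adj]
  have hne : v + 1 ≠ v - 1 := by
    intro e
    have h2 : (1 + 1 : Fin (m + 3)) = 0 := by
      have := congrArg (fun x => x - v + 1) e
      simpa [sub_eq_add_neg, add_comm, add_left_comm] using this
    simp [Fin.ext_iff, Fin.val_add, Nat.mod_eq_of_lt (show 2 < m + 3 by omega)] at h2
  obtain ⟨u, hu, huniq⟩ := hf.2 v ⟨_, hadd⟩
  have hcases : u = v + 1 ∨ u = v - 1 := by
    rw [cycleGraph_adj] at hu
    rcases hu with hu | hu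
    · exact Or.inr (by rw [← hu]; abel)
    · exact Or.inl (by rw [← hu]; abel)
  rcases hcases with rfl | rfl
  · exact hne (huniq _ hsub h.symm).symm
  · exact hne (huniq _ hadd h)

/-- For every `n ≥ 4` with `n ≢ 0 (mod 3)`, the cycle `Cₙ` has no proper
conflict-free `3`-coloring. -/
theorem no_pcf_three_cycle {n : ℕ} (hn : 4 ≤ n) (h3 : ¬ (3 ∣ n)) :
    ¬ ∃ f : Fin n → Fin 3, IsPCFColoring (SimpleGraph.cycleGraph n) f := by
  rintro ⟨f, hf⟩
  obtain ⟨m, rfl⟩ : ∃ m, n = m + 3 := ⟨n - 3, by omega⟩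
  let g : ℕ → Fin 3 := fun k => f (k • 1)
  have hg1 (k : ℕ) : g (k + 1) ≠ g k := hf.1 (by simp [cycleGraph_adj, succ_nsmul])
  have hg2 (k : ℕ) : g (k + 2) ≠ g k := by
    have h := hf.cycleGraph_add_one_ne_sub_one ((k + 1) • 1)
    rwa [← succ_nsmul, succ_nsmul 1 k, add_sub_cancel_right] at h
  have hper : Function.Periodic g 3 := by
    intro k
    have h1 := hg1 k
    have h2 := hg1 (k + 1)
    have h3 := hg1 (k + 2)
    have h4 := hg2 k
    have h5 := hg2 (k + 1)
    simp only [add_assoc, Nat.reduceAdd] at h2 h3 h5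
    omega
  have hclose : g ((m + 3) % 3) = g 0 := by
    rw [hper.map_mod_nat]
    have h : (m + 3) • (1 : Fin (m + 3)) = 0 := by
      simpa using card_nsmul_eq_zero' (G := Fin (m + 3)) (x := 1)
    simp only [g, h, zero_nsmul]
  have hmod : (m + 3) % 3 = 1 ∨ (m + 3) % 3 = 2 := by omega
  rcases hmod with h | h
  · exact hg1 0 (by rwa [h] at hclose)
  · exact hg2 0 (by rwa [h] at hclose)
end

section
/- For every integer n ≥ 3, the 1-subdivision K*_n of the complete graph K_n satisfies mad(K*_n) = 4(n−1)/(n+1); equivalently, for c = n − 1, mad(K*_{c+1}) = 4c/(c+2). -/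
open SimpleGraph

namespace Subdiv

variable {V : Type*} {G : SimpleGraph V}

theorem adj_inl_inr {v : V} {e : G.edgeSet} :
    (Subdiv G).Adj (Sum.inl v) (Sum.inr e) ↔ v ∈ (e : Sym2 V) := by
  simp [Subdiv]

theorem adj_inr_inl {v : V} {e : G.edgeSet} :
    (Subdiv G).Adj (Sum.inr e) (Sum.inl v) ↔ v ∈ (e : Sym2 V) := by
  simp [Subdiv]

theorem not_adj_inl_inl {v w : V} : ¬ (Subdiv G).Adj (Sum.inl v) (Sum.inl w) := by
  simp [Subdiv]

theorem not_adj_inr_inr {e f : G.edgeSet} : ¬ (Subdiv G).Adj (Sum.inr e) (Sum.inr f) := by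
  simp [Subdiv]

theorem ncard_neighborSet_inl (v : V) :
    ((Subdiv G).neighborSet (Sum.inl v)).ncard = (G.incidenceSet v).ncard := by
  have h : (Subdiv G).neighborSet (Sum.inl v) = Sum.inr '' {e : G.edgeSet | v ∈ (e : Sym2 V)} := by
    ext (w | e)
    · simp [not_adj_inl_inl]
    · simp [adj_inl_inr]
  have h' : G.incidenceSet v = Subtype.val '' {e : G.edgeSet | v ∈ (e : Sym2 V)} := by
    ext e
    simp [SimpleGraph.incidenceSet, and_comm]
  rw [h, h', Set.ncard_image_of_injective _ Sum.inr_injective,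
    Set.ncard_image_of_injective _ Subtype.val_injective]

theorem ncard_neighborSet_inr (e : G.edgeSet) :
    ((Subdiv G).neighborSet (Sum.inr e)).ncard = 2 := by
  have h : (Subdiv G).neighborSet (Sum.inr e) = Sum.inl '' {v : V | v ∈ (e : Sym2 V)} := by
    ext (w | e)
    · simp [adj_inr_inl]
    · simp [not_adj_inr_inr]
  rw [h, Set.ncard_image_of_injective _ Sum.inl_injective]
  obtain ⟨e, he⟩ := e
  induction e with
  | h x y =>
    have hxy : x ≠ y := G.ne_of_adj he
    have : {v : V | v ∈ s(x, y)} = {x, y} := by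
      ext v
      simp
    rw [this, Set.ncard_pair hxy]

/-- The edges of a spanning subgraph of `Subdiv G` are counted by the degrees on either side of
the bipartition. -/
theorem ncard_edgeSet_eq_sum [Fintype V] [Fintype G.edgeSet] {K : SimpleGraph (V ⊕ G.edgeSet)}
    (hK : K ≤ Subdiv G) :
    K.edgeSet.ncard = ∑ v : V, (K.neighborSet (Sum.inl v)).ncard ∧
      K.edgeSet.ncard = ∑ e : G.edgeSet, (K.neighborSet (Sum.inr e)).ncard := by
  classical
  have hbip : K.IsBipartiteWith (Finset.univ.map Function.Embedding.inl : Finset (V ⊕ G.edgeSet))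
      (Finset.univ.map Function.Embedding.inr : Finset (V ⊕ G.edgeSet)) := by
    refine ⟨?_, ?_⟩
    · simp [Set.disjoint_left]
    · rintro (v | e) (w | f) h
      · exact (not_adj_inl_inl (hK h)).elim
      · simp
      · simp
      · exact (not_adj_inr_inr (hK h)).elim
  have hE : K.edgeSet.ncard = K.edgeFinset.card := Set.ncard_eq_toFinset_card' _
  have hd : ∀ x, (K.neighborSet x).ncard = K.degree x := fun x =>
    Set.ncard_eq_toFinset_card' _
  have h1 := SimpleGraph.isBipartiteWith_sum_degrees_eq_card_edges hbip
  have h2 := SimpleGraph.isBipartiteWith_sum_degrees_eq_card_edges' hbip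
  rw [Finset.sum_map] at h1 h2
  simp only [hE, hd]
  exact ⟨h1.symm, h2.symm⟩

end Subdiv

/-- If the vertices `i x` have degree at most `d`, then their degrees in a subgraph `H` sum to at
most `d` times the number of them in `H`. -/
theorem SimpleGraph.Subgraph.sum_ncard_neighborSet_le {W ι : Type*} [Finite W] [Fintype ι]
    {K : SimpleGraph W}
    (H : K.Subgraph) (i : ι → W) {d : ℕ} (hd : ∀ x, (K.neighborSet (i x)).ncard ≤ d) :
    ∑ x, (H.neighborSet (i x)).ncard ≤ d * (i ⁻¹' H.verts).ncard := by
  classical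
  calc ∑ x, (H.neighborSet (i x)).ncard
      ≤ ∑ x, if x ∈ i ⁻¹' H.verts then d else 0 := by
        refine Finset.sum_le_sum fun x _ => ?_
        split_ifs with hx
        · exact (Set.ncard_le_ncard (H.neighborSet_subset _)).trans (hd x)
        · have : H.neighborSet (i x) = ∅ :=
            Set.eq_empty_of_forall_notMem fun y hy => hx (H.edge_vert hy)
          simp [this]
    _ = d * (i ⁻¹' H.verts).ncard := by
        rw [← Finset.sum_filter, Finset.sum_const, smul_eq_mul, mul_comm,
          ← Set.ncard_coe_finset, Finset.coe_filter_univ, Set.ofPred_mem_eq]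

theorem ncard_incidenceSet_completeGraph {n : ℕ} (v : Fin n) :
    ((completeGraph (Fin n)).incidenceSet v).ncard = n - 1 := by
  classical
  rw [← SimpleGraph.coe_incidenceFinset, Set.ncard_coe_finset,
    SimpleGraph.card_incidenceFinset_eq_degree]
  simp

theorem Set.ncard_eq_ncard_preimage_inl_add_inr {α β : Type*} [Finite α] [Finite β]
    (s : Set (α ⊕ β)) :
    s.ncard = (Sum.inl ⁻¹' s).ncard + (Sum.inr ⁻¹' s).ncard := by
  conv_lhs => rw [← Set.image_preimage_inl_union_image_preimage_inr s]
  rw [Set.ncard_union_eq (by simp [Set.disjoint_left]),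
    Set.ncard_image_of_injective _ Sum.inl_injective,
    Set.ncard_image_of_injective _ Sum.inr_injective]

/-- For every `n ≥ 3`, `mad(K*_n) = 4(n-1)/(n+1)`: every nonempty subgraph has
average degree at most `4(n-1)/(n+1)`, and this value is attained. -/
theorem mad_KStar {n : ℕ} (hn : 3 ≤ n) :
    MadLE (KStarGraph n) (4 * ((n : ℚ) - 1) / ((n : ℚ) + 1)) ∧
    ∃ H : (KStarGraph n).Subgraph, H.verts.Nonempty ∧
      (2 * H.edgeSet.ncard : ℚ) = (4 * ((n : ℚ) - 1) / ((n : ℚ) + 1)) * H.verts.ncard := by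
  have hn' : (0 : ℚ) < (n : ℚ) + 1 := by positivity
  have hn1 : (((n - 1 : ℕ)) : ℚ) = (n : ℚ) - 1 := by
    rw [Nat.cast_sub (by omega), Nat.cast_one]
  have hinl : ∀ v, ((KStarGraph n).neighborSet (Sum.inl v)).ncard = n - 1 := fun v =>
    (Subdiv.ncard_neighborSet_inl v).trans (ncard_incidenceSet_completeGraph v)
  have hinr : ∀ e, ((KStarGraph n).neighborSet (Sum.inr e)).ncard = 2 :=
    Subdiv.ncard_neighborSet_inr
  refine ⟨fun H _ => ?_, ⊤, ⟨Sum.inl ⟨0, by omega⟩, trivial⟩, ?_⟩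
  · obtain ⟨h1, h2⟩ := Subdiv.ncard_edgeSet_eq_sum H.spanningCoe_le
    have h1' := h1.trans_le (H.sum_ncard_neighborSet_le Sum.inl fun v => (hinl v).le)
    have h2' := h2.trans_le (H.sum_ncard_neighborSet_le Sum.inr fun e => (hinr e).le)
    rw [SimpleGraph.Subgraph.edgeSet_spanningCoe] at h1' h2'
    rw [Set.ncard_eq_ncard_preimage_inl_add_inr H.verts, div_mul_eq_mul_div, le_div_iff₀ hn']
    have q1 : (H.edgeSet.ncard : ℚ) ≤ ((n : ℚ) - 1) * (Sum.inl ⁻¹' H.verts).ncard := by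
      rw [← hn1]
      exact_mod_cast h1'
    have q2 : (H.edgeSet.ncard : ℚ) ≤ 2 * (Sum.inr ⁻¹' H.verts).ncard := by
      exact_mod_cast h2'
    have q3 := mul_le_mul_of_nonneg_left q2 (hn1 ▸ Nat.cast_nonneg (n - 1) : (0 : ℚ) ≤ n - 1)
    push_cast
    linarith
  · obtain ⟨h1, h2⟩ := Subdiv.ncard_edgeSet_eq_sum (le_refl (KStarGraph n))
    simp only [hinl, hinr, Finset.sum_const, Finset.card_univ, smul_eq_mul, Fintype.card_fin]
      at h1 h2
    rw [SimpleGraph.Subgraph.edgeSet_top, SimpleGraph.Subgraph.verts_top, Set.ncard_univ,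
      Nat.card_sum, Nat.card_eq_fintype_card, Nat.card_eq_fintype_card, Fintype.card_fin,
      div_mul_eq_mul_div, eq_div_iff hn'.ne']
    have q1 : ((KStarGraph n).edgeSet.ncard : ℚ) = n * ((n : ℚ) - 1) := by
      rw [← hn1]
      exact_mod_cast h1
    have q2 : ((KStarGraph n).edgeSet.ncard : ℚ) =
        Fintype.card (completeGraph (Fin n)).edgeSet * 2 := by
      exact_mod_cast h2
    push_cast
    linear_combination 4 * q1 + 2 * ((n : ℚ) - 1) * q2
end

section
/- For every integer n ≥ 3, the 1-subdivision K*_n of the complete graph K_n has no proper conflict-free (n−1)-coloring; that is, χ_pcf(K*_n) ≥ n. -/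
open SimpleGraph

/-- For every `n ≥ 3`, the 1-subdivision `K*_n` of `K_n` has no proper
conflict-free `(n-1)`-coloring. -/
theorem no_pcf_KStar {n : ℕ} (hn : 3 ≤ n) :
    ¬ ∃ f : (Fin n ⊕ (completeGraph (Fin n)).edgeSet) → Fin (n - 1),
      IsPCFColoring (KStarGraph n) f := by
  rintro ⟨f, -, hf⟩
  have hcard : Fintype.card (Fin (n - 1)) < Fintype.card (Fin n) := by
    simp only [Fintype.card_fin]
    omega
  obtain ⟨u, v, huv, hcol⟩ :=
    Fintype.exists_ne_map_eq_of_card_lt (fun x : Fin n => f (Sum.inl x)) hcard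
  let e : (completeGraph (Fin n)).edgeSet := ⟨s(u, v), huv⟩
  have hadj (x : Fin n) (hx : x ∈ s(u, v)) : (KStarGraph n).Adj (Sum.inr e) (Sum.inl x) :=
    ⟨Sum.inr_ne_inl, Or.inr hx⟩
  have hu := hadj u (Sym2.mem_mk_left u v)
  have hv := hadj v (Sym2.mem_mk_right u v)
  obtain ⟨w, ⟨-, hw⟩, hunique⟩ := hf (Sum.inr e) ⟨_, hu⟩
  rcases w with x | e'
  · have hx : x ∈ s(u, v) := hw.resolve_left id
    rcases Sym2.mem_iff.mp hx with rfl | rfl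
    · exact huv (Sum.inl_injective (hunique _ hv hcol.symm)).symm
    · exact huv (Sum.inl_injective (hunique _ hu hcol))
  · exact hw.elim id id
end
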